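/- There is no algorithm (no total computable function, for any fixed effective encoding of instances by natural numbers) that, given a 2-dimensional affine graph-directed iterated function system with 3 vertices whose maps are contracting affine maps with rational coefficients and in which every vertex has at least one outgoing edge, together with a distinguished vertex q, decides whether the attractor component X_q has empty interior in ℝ². -/

import Mathlib

/-- An edge of a 2-dimensional affine GIFS on 3 vertices with rational coefficients:
source vertex, target vertex, rational 2×2 matrix, rational translation vector. -/
abbrev GifsEdge : Type := Fin 3 × Fin 3 × (Fin 2 → Fin 2 → ℚ) × (Fin 2 → ℚ)

/-- The affine map `x ↦ M x + v` on ℝ² determined by a rational matrix and vector. -/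
noncomputable def gifsEdgeMap (M : Fin 2 → Fin 2 → ℚ) (v : Fin 2 → ℚ) :
    EuclideanSpace ℝ (Fin 2) → EuclideanSpace ℝ (Fin 2) :=
  fun x => (WithLp.equiv 2 (Fin 2 → ℝ)).symm
    (fun i => (∑ j, (M i j : ℝ) * x j) + (v i : ℝ))

/-- A map on ℝ² is contracting: Lipschitz with some constant `c < 1`. -/
def IsContractingMap (f : EuclideanSpace ℝ (Fin 2) → EuclideanSpace ℝ (Fin 2)) : Prop :=
  ∃ c : NNReal, c < 1 ∧ LipschitzWith c f

/-- Well-formed instance: every edge map is contracting and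
every vertex has at least one outgoing edge. -/
def GifsWF (L : List GifsEdge) : Prop :=
  (∀ e ∈ L, IsContractingMap (gifsEdgeMap e.2.2.1 e.2.2.2)) ∧
  (∀ q : Fin 3, ∃ e ∈ L, e.1 = q)

/-- `X` is the family of attractors of the GIFS: a family of nonempty compact sets
satisfying the graph-directed fixed-point equations. -/
def IsGifsAttractor (L : List GifsEdge) (X : Fin 3 → Set (EuclideanSpace ℝ (Fin 2))) : Prop :=
  (∀ q, (X q).Nonempty ∧ IsCompact (X q)) ∧
  (∀ q, X q = ⋃ e ∈ L, ⋃ (_ : e.1 = q), gifsEdgeMap e.2.2.1 e.2.2.2 '' X e.2.1)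

/-! ### Expansions over a finite alphabet -/

section Expansion

variable {X : Type} [Fintype X]

/-- The contraction of the unit interval that prepends the letter `a` to an expansion. -/
noncomputable def letterMap (a : X) (t : ℝ) : ℝ :=
  ((Fintype.equivFin X a : ℕ) + t) / Fintype.card X

/-- The contraction of the unit interval that prepends the word `s` to an expansion. -/
noncomputable def wordMap (s : List X) (t : ℝ) : ℝ :=
  s.foldr letterMap t

/-- The real number whose expansion is the sequence `x`. -/
noncomputable def streamVal (x : Stream' X) : ℝ :=
  Real.ofDigits fun n => Fintype.equivFin X (x.get n)

@[simp] theorem wordMap_nil (t : ℝ) : wordMap ([] : List X) t = t := rfl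

@[simp] theorem wordMap_cons (a : X) (s : List X) (t : ℝ) :
    wordMap (a :: s) t = letterMap a (wordMap s t) := rfl

theorem wordMap_append (s s' : List X) (t : ℝ) :
    wordMap (s ++ s') t = wordMap s (wordMap s' t) := by
  simp [wordMap]

theorem streamVal_mem (x : Stream' X) : streamVal x ∈ Set.Icc (0 : ℝ) 1 :=
  ⟨Real.ofDigits_nonneg _, Real.ofDigits_le_one _⟩

theorem streamVal_cons (a : X) (x : Stream' X) :
    streamVal (Stream'.cons a x) = letterMap a (streamVal x) := by
  unfold streamVal letterMap
  rw [Real.ofDigits_eq_sum_add_ofDigits _ 1]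
  simp only [Finset.sum_range_one, Real.ofDigitsTerm, Stream'.get_zero_cons, zero_add, pow_one]
  rw [add_div, div_eq_mul_inv, div_eq_mul_inv, mul_comm (Real.ofDigits _)]
  rfl

theorem streamVal_append (s : List X) (x : Stream' X) :
    streamVal (s ++ₛ x) = wordMap s (streamVal x) := by
  induction s with
  | nil => rfl
  | cons a s ih => rw [Stream'.cons_append_stream, streamVal_cons, ih, wordMap_cons]

theorem digit_add_one_le (a : X) :
    ((Fintype.equivFin X a : ℕ) : ℝ) + 1 ≤ Fintype.card X := by
  exact_mod_cast (Fintype.equivFin X a).2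

variable [Nontrivial X]

theorem exists_streamVal_eq {t : ℝ} (ht : t ∈ Set.Icc (0 : ℝ) 1) :
    ∃ x : Stream' X, streamVal x = t := by
  obtain ⟨d, -, hd⟩ := Real.ofDigits_SurjOn (Fintype.one_lt_card (α := X)) ht
  refine ⟨fun n => (Fintype.equivFin X).symm (d n), ?_⟩
  simpa [streamVal, Stream'.get] using hd

theorem two_le_card_cast (X : Type) [Fintype X] [Nontrivial X] :
    (2 : ℝ) ≤ Fintype.card X := by
  exact_mod_cast Fintype.one_lt_card (α := X)

theorem letterMap_le {c t : ℝ} (hc : 0 ≤ c) (ht : t ≤ 1 + c) (a : X) :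
    letterMap a t ≤ 1 + c / 2 := by
  have h2 := two_le_card_cast X
  have h1 := digit_add_one_le a
  unfold letterMap
  rw [div_le_iff₀ (by linarith)]
  nlinarith

theorem le_letterMap {c t : ℝ} (hc : 0 ≤ c) (ht : -c ≤ t) (a : X) :
    -(c / 2) ≤ letterMap a t := by
  have h2 := two_le_card_cast X
  unfold letterMap
  rw [le_div_iff₀ (by linarith)]
  nlinarith [Nat.cast_nonneg (α := ℝ) (Fintype.equivFin X a : ℕ)]

theorem wordMap_le {c t : ℝ} (hc : 0 ≤ c) (ht : t ≤ 1 + c) {s : List X} (hs : s ≠ []) :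
    wordMap s t ≤ 1 + c / 2 := by
  induction s with
  | nil => exact absurd rfl hs
  | cons a s ih =>
    refine letterMap_le hc ?_ a
    rcases eq_or_ne s [] with rfl | h
    · simpa using ht
    · exact (ih h).trans (by linarith)

theorem le_wordMap {c t : ℝ} (hc : 0 ≤ c) (ht : -c ≤ t) {s : List X} (hs : s ≠ []) :
    -(c / 2) ≤ wordMap s t := by
  induction s with
  | nil => exact absurd rfl hs
  | cons a s ih =>
    refine le_letterMap hc ?_ a
    rcases eq_or_ne s [] with rfl | h
    · simpa using ht
    · exact le_trans (by linarith) (ih h)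

theorem wordMap_mem_Icc {t : ℝ} (ht : t ∈ Set.Icc (0 : ℝ) 1) (s : List X) :
    wordMap s t ∈ Set.Icc (0 : ℝ) 1 := by
  rcases eq_or_ne s [] with rfl | h
  · simpa using ht
  · constructor
    · simpa using le_wordMap le_rfl (by simpa using ht.1) h
    · simpa using wordMap_le le_rfl (by simpa using ht.2) h

theorem letterMap_mem_Ioo {t : ℝ} (ht : t ∈ Set.Ioo (0 : ℝ) 1) (a : X) :
    letterMap a t ∈ Set.Ioo (0 : ℝ) 1 := by
  have h2 := two_le_card_cast X
  have h1 := digit_add_one_le a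
  have h0 := Nat.cast_nonneg (α := ℝ) (Fintype.equivFin X a : ℕ)
  unfold letterMap
  refine ⟨div_pos (by linarith [ht.1]) (by linarith), ?_⟩
  rw [div_lt_one (by linarith)]
  linarith [ht.2]

theorem wordMap_mem_Ioo {t : ℝ} (ht : t ∈ Set.Ioo (0 : ℝ) 1) (s : List X) :
    wordMap s t ∈ Set.Ioo (0 : ℝ) 1 := by
  induction s with
  | nil => exact ht
  | cons a s ih => exact letterMap_mem_Ioo ih a

theorem letterMap_injective {a b : X} {t t' : ℝ} (ht : t ∈ Set.Icc (0 : ℝ) 1)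
    (ht' : t' ∈ Set.Ioo (0 : ℝ) 1) (h : letterMap a t = letterMap b t') : a = b ∧ t = t' := by
  have h2 := two_le_card_cast X
  unfold letterMap at h
  rw [div_left_inj' (by linarith)] at h
  have hab : Fintype.equivFin X a = Fintype.equivFin X b := by
    rcases lt_trichotomy (Fintype.equivFin X a : ℕ) (Fintype.equivFin X b) with hlt | heq | hlt
    · have : ((Fintype.equivFin X a : ℕ) : ℝ) + 1 ≤ (Fintype.equivFin X b : ℕ) := by
        exact_mod_cast hlt
      linarith [ht.2, ht'.1]
    · exact Fin.ext heq
    · have : ((Fintype.equivFin X b : ℕ) : ℝ) + 1 ≤ (Fintype.equivFin X a : ℕ) := by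
        exact_mod_cast hlt
      linarith [ht.1, ht'.2]
  rw [hab] at h
  exact ⟨(Fintype.equivFin X).injective hab, by linarith⟩

theorem exists_append_of_wordMap_eq {b s : List X} {t t' : ℝ} (ht : t ∈ Set.Icc (0 : ℝ) 1)
    (ht' : t' ∈ Set.Ioo (0 : ℝ) 1) (hbs : s <+: b → b.length ≤ s.length)
    (h : wordMap b t = wordMap s t') : ∃ s', s = b ++ s' ∧ t = wordMap s' t' := by
  induction b generalizing s with
  | nil => exact ⟨s, rfl, h⟩
  | cons a b ih =>
    cases s with
    | nil => simp at hbs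
    | cons c s =>
      obtain ⟨rfl, h'⟩ := letterMap_injective (wordMap_mem_Icc ht b) (wordMap_mem_Ioo ht' s) h
      obtain ⟨s', rfl, hs'⟩ := ih (by simpa using hbs) h'
      exact ⟨s', rfl, hs'⟩

theorem abs_wordMap_sub (s : List X) (t t' : ℝ) :
    |wordMap s t - wordMap s t'| ≤ (1 / 2) ^ s.length * |t - t'| := by
  induction s with
  | nil => simp
  | cons a s ih =>
    have h2 := two_le_card_cast X
    have h : letterMap a (wordMap s t) - letterMap a (wordMap s t') =
        (wordMap s t - wordMap s t') / Fintype.card X := by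
      unfold letterMap; ring
    rw [wordMap_cons, wordMap_cons, h, abs_div,
      abs_of_nonneg (by linarith : (0 : ℝ) ≤ (Fintype.card X : ℝ)), List.length_cons, pow_succ]
    calc _ ≤ |wordMap s t - wordMap s t'| / 2 := by gcongr
      _ ≤ _ := by linarith

theorem exists_wordMap_near {t ε : ℝ} (ht : t ∈ Set.Icc (0 : ℝ) 1) (hε : 0 < ε) :
    ∃ s : List X, ∀ z ∈ Set.Icc (0 : ℝ) 1, |wordMap s z - t| < ε := by
  obtain ⟨x, rfl⟩ := exists_streamVal_eq (X := X) ht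
  obtain ⟨n, hn⟩ := exists_pow_lt_of_lt_one hε (by norm_num : (1 / 2 : ℝ) < 1)
  refine ⟨x.take n, fun z hz => ?_⟩
  have hx : streamVal x = wordMap (x.take n) (streamVal (x.drop n)) := by
    rw [← streamVal_append, Stream'.append_take_drop]
  have hd : |z - streamVal (x.drop n)| ≤ 1 := by
    have := streamVal_mem (x.drop n)
    rw [abs_le]
    constructor <;> linarith [hz.1, hz.2, this.1, this.2]
  rw [hx]
  calc _ ≤ (1 / 2) ^ (x.take n).length * |z - streamVal (x.drop n)| := abs_wordMap_sub _ _ _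
    _ ≤ (1 / 2) ^ n * 1 := by rw [Stream'.length_take]; gcongr
    _ < ε := by simpa using hn

/-- The numerator of the image of `0` under `wordMap s`, over the denominator
`(Fintype.card X) ^ s.length`. -/
noncomputable def wordNum (s : List X) : ℕ :=
  s.foldl (fun n a => n * Fintype.card X + (Fintype.equivFin X a : ℕ)) 0

theorem wordMap_eq (s : List X) (t : ℝ) :
    wordMap s t = (wordNum s + t) / (Fintype.card X : ℝ) ^ s.length := by
  induction s using List.reverseRecOn generalizing t with
  | nil => simp [wordNum]
  | append_singleton s a ih =>
    have h2 := two_le_card_cast X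
    have hn : wordNum (s ++ [a]) =
        wordNum s * Fintype.card X + (Fintype.equivFin X a : ℕ) := by
      simp [wordNum]
    rw [wordMap_append, ih, hn, List.length_append, List.length_singleton, pow_succ]
    simp only [wordMap_cons, wordMap_nil, letterMap]
    push_cast
    field_simp
    ring

end Expansion

/-! ### Graph-directed systems reading pairs of expansions -/

section Gifs

variable {X Y : Type} [Fintype X] [Fintype Y]

/-- An edge of a two-tape automaton: source, target, first tape letter, second tape word. -/
abbrev TapeEdge (X Y : Type) : Type := Fin 3 × Fin 3 × X × List Y

/-- The affine edge prepending `e.2.2.1` to the first and `e.2.2.2` to the second coordinate. -/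
noncomputable def TapeEdge.toGifs (e : TapeEdge X Y) : GifsEdge :=
  (e.1, e.2.1,
    fun i j => if i = j then
      if i = 0 then 1 / (Fintype.card X : ℚ) else 1 / (Fintype.card Y : ℚ) ^ e.2.2.2.length
    else 0,
    fun i => if i = 0 then ((Fintype.equivFin X e.2.2.1 : ℕ) : ℚ) / Fintype.card X
      else (wordNum e.2.2.2 : ℚ) / (Fintype.card Y : ℚ) ^ e.2.2.2.length)

/-- The map on the plane attached to an edge of a two-tape automaton. -/
noncomputable abbrev TapeEdge.map (e : TapeEdge X Y) :
    EuclideanSpace ℝ (Fin 2) → EuclideanSpace ℝ (Fin 2) :=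
  gifsEdgeMap e.toGifs.2.2.1 e.toGifs.2.2.2

theorem TapeEdge.map_zero (e : TapeEdge X Y) (p : EuclideanSpace ℝ (Fin 2)) :
    e.map p 0 = letterMap e.2.2.1 (p 0) := by
  simp [gifsEdgeMap, toGifs, letterMap]
  ring

theorem TapeEdge.map_one [Nontrivial Y] (e : TapeEdge X Y) (p : EuclideanSpace ℝ (Fin 2)) :
    e.map p 1 = wordMap e.2.2.2 (p 1) := by
  rw [wordMap_eq]
  simp [gifsEdgeMap, toGifs]
  ring

theorem TapeEdge.map_toLp [Nontrivial Y] (e : TapeEdge X Y) (u v : ℝ) :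
    e.map !₂[u, v] = !₂[letterMap e.2.2.1 u, wordMap e.2.2.2 v] := by
  ext i
  fin_cases i
  · simpa using e.map_zero !₂[u, v]
  · simpa using e.map_one !₂[u, v]

theorem TapeEdge.isContractingMap [Nontrivial X] [Nontrivial Y] (e : TapeEdge X Y)
    (he : e.2.2.2 ≠ []) : IsContractingMap e.map := by
  refine ⟨1 / 2, by norm_num [← NNReal.coe_lt_coe], LipschitzWith.of_dist_le_mul fun p p' => ?_⟩
  have h0 : |e.map p 0 - e.map p' 0| ≤ 1 / 2 * |p 0 - p' 0| := by
    rw [e.map_zero, e.map_zero]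
    simpa using abs_wordMap_sub [e.2.2.1] (p 0) (p' 0)
  have h1 : |e.map p 1 - e.map p' 1| ≤ 1 / 2 * |p 1 - p' 1| := by
    rw [e.map_one, e.map_one]
    refine (abs_wordMap_sub e.2.2.2 (p 1) (p' 1)).trans ?_
    gcongr
    exact (pow_le_pow_of_le_one (by norm_num) (by norm_num)
      (List.length_pos_iff.2 he)).trans_eq (pow_one _)
  rw [EuclideanSpace.dist_eq, EuclideanSpace.dist_eq]
  have hsq : ((1 / 2 : NNReal) : ℝ) * √(∑ i, dist (p i) (p' i) ^ 2) =
      √((1 / 2) ^ 2 * ∑ i, dist (p i) (p' i) ^ 2) := by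
    rw [Real.sqrt_mul (by positivity), Real.sqrt_sq (by norm_num)]
    norm_num
  rw [hsq]
  apply Real.sqrt_le_sqrt
  simp only [Fin.sum_univ_two, Real.dist_eq, mul_add, ← mul_pow]
  gcongr

theorem gifsWF_map_toGifs [Nontrivial X] [Nontrivial Y] {E : List (TapeEdge X Y)}
    (hE : ∀ e ∈ E, e.2.2.2 ≠ []) (hq : ∀ q, ∃ e ∈ E, e.1 = q) :
    GifsWF (E.map TapeEdge.toGifs) := by
  constructor
  · intro e he
    obtain ⟨e, he', rfl⟩ := List.mem_map.1 he
    exact e.isContractingMap (hE e he')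
  · intro q
    obtain ⟨e, he, rfl⟩ := hq q
    exact ⟨_, List.mem_map_of_mem he, rfl⟩

/-- The operator whose fixed points are the attractors of `E`. -/
noncomputable def hutchinson (E : List (TapeEdge X Y)) :
    (Fin 3 → Set (EuclideanSpace ℝ (Fin 2))) →o (Fin 3 → Set (EuclideanSpace ℝ (Fin 2))) where
  toFun Z q := ⋃ e ∈ E, ⋃ (_ : e.1 = q), e.map '' Z e.2.1
  monotone' Z Z' h q := by
    dsimp only
    gcongr
    exact h _

theorem mem_hutchinson {E : List (TapeEdge X Y)} {Z : Fin 3 → Set (EuclideanSpace ℝ (Fin 2))}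
    {q : Fin 3} {p : EuclideanSpace ℝ (Fin 2)} :
    p ∈ hutchinson E Z q ↔ ∃ e ∈ E, e.1 = q ∧ ∃ p' ∈ Z e.2.1, e.map p' = p := by
  change p ∈ ⋃ e ∈ E, ⋃ (_ : e.1 = q), e.map '' Z e.2.1 ↔ _
  simp only [Set.mem_iUnion, exists_prop, Set.mem_image]

theorem isGifsAttractor_iff {E : List (TapeEdge X Y)}
    {Z : Fin 3 → Set (EuclideanSpace ℝ (Fin 2))} :
    IsGifsAttractor (E.map TapeEdge.toGifs) Z ↔
      (∀ q, (Z q).Nonempty ∧ IsCompact (Z q)) ∧ Z = hutchinson E Z := by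
  refine and_congr_right fun _ => ?_
  rw [funext_iff]
  refine forall_congr' fun q => ?_
  suffices h : hutchinson E Z q = ⋃ e ∈ E.map TapeEdge.toGifs, ⋃ (_ : e.1 = q),
    gifsEdgeMap e.2.2.1 e.2.2.2 '' Z e.2.1 by rw [h]
  ext p
  rw [mem_hutchinson]
  simp only [Set.mem_iUnion, exists_prop, List.mem_map, exists_exists_and_eq_and]
  rfl

/-- The closed unit square. -/
def unitSquare : Set (EuclideanSpace ℝ (Fin 2)) := {p | ∀ i, p i ∈ Set.Icc (0 : ℝ) 1}

theorem isCompact_unitSquare : IsCompact unitSquare := by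
  have h : IsCompact (Set.univ.pi fun _ : Fin 2 => Set.Icc (0 : ℝ) 1) :=
    isCompact_univ_pi fun _ => isCompact_Icc
  have h' := (EuclideanSpace.equiv (Fin 2) ℝ).toHomeomorph.isCompact_preimage.2 h
  convert h' using 1
  ext p
  simp only [unitSquare, Set.mem_preimage, Set.mem_univ_pi]
  rfl

theorem TapeEdge.map_mem_unitSquare [Nontrivial X] [Nontrivial Y] (e : TapeEdge X Y)
    {p : EuclideanSpace ℝ (Fin 2)} (hp : p ∈ unitSquare) : e.map p ∈ unitSquare := by
  intro i
  fin_cases i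
  · exact e.map_zero p ▸ wordMap_mem_Icc (hp 0) [e.2.2.1]
  · exact e.map_one p ▸ wordMap_mem_Icc (hp 1) e.2.2.2

theorem continuous_gifsEdgeMap (M : Fin 2 → Fin 2 → ℚ) (v : Fin 2 → ℚ) :
    Continuous (gifsEdgeMap M v) := by
  refine (PiLp.continuous_toLp 2 (fun _ : Fin 2 => ℝ)).comp ?_
  fun_prop

theorem isCompact_hutchinson {E : List (TapeEdge X Y)}
    {Z : Fin 3 → Set (EuclideanSpace ℝ (Fin 2))} (hZ : ∀ q, IsCompact (Z q)) (q : Fin 3) :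
    IsCompact (hutchinson E Z q) := by
  have h : hutchinson E Z q = ⋃ e ∈ {e | e ∈ E}, ⋃ (_ : e.1 = q), e.map '' Z e.2.1 := rfl
  rw [h]
  refine (List.finite_toSet E).isCompact_biUnion fun e _ => ?_
  refine isCompact_iUnion fun _ => (hZ _).image (continuous_gifsEdgeMap _ _)

/-- A family of pairs of sequences in which every pair can be read along some edge is
contained in an attractor. -/
theorem exists_isGifsAttractor [Nontrivial X] [Nontrivial Y] {E : List (TapeEdge X Y)}
    {P : Fin 3 → Stream' X → Stream' Y → Prop} (hne : ∀ q, ∃ x y, P q x y)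
    (hP : ∀ q x y, P q x y → ∃ r a b, (q, r, a, b) ∈ E ∧
      ∃ x' y', x = Stream'.cons a x' ∧ y = b ++ₛ y' ∧ P r x' y') :
    ∃ Z, IsGifsAttractor (E.map TapeEdge.toGifs) Z ∧
      ∀ q x y, P q x y → !₂[streamVal x, streamVal y] ∈ Z q := by
  let f : (Fin 3 → Set (EuclideanSpace ℝ (Fin 2))) →o (Fin 3 → Set (EuclideanSpace ℝ (Fin 2))) :=
    ⟨fun Z q => unitSquare ∩ hutchinson E Z q, fun Z Z' h q =>
      Set.inter_subset_inter_right _ ((hutchinson E).monotone h q)⟩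
  have hf : f f.gfp = f.gfp := f.map_gfp
  have hsq (q) : f.gfp q ⊆ unitSquare := fun p hp => by
    rw [← hf] at hp
    exact hp.1
  have hfix : f.gfp = hutchinson E f.gfp := by
    refine le_antisymm (fun q p hp => ?_) (fun q p hp => ?_)
    · rw [← hf] at hp
      exact hp.2
    · rw [← hf]
      refine ⟨?_, hp⟩
      obtain ⟨e, -, -, p', hp', rfl⟩ := mem_hutchinson.1 hp
      exact e.map_mem_unitSquare (hsq _ hp')
  have hmem : ∀ q x y, P q x y → !₂[streamVal x, streamVal y] ∈ f.gfp q := by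
    have hle : (fun q => {p | ∃ x y, P q x y ∧ p = !₂[streamVal x, streamVal y]}) ≤ f.gfp := by
      refine f.le_gfp fun q p hp => ?_
      obtain ⟨x, y, h, rfl⟩ := hp
      refine ⟨fun i => ?_, ?_⟩
      · fin_cases i
        · exact streamVal_mem x
        · exact streamVal_mem y
      · obtain ⟨r, a, b, he, x', y', rfl, rfl, h'⟩ := hP q x y h
        refine mem_hutchinson.2 ⟨_, he, rfl, _, ⟨x', y', h', rfl⟩, ?_⟩
        rw [TapeEdge.map_toLp, streamVal_cons, streamVal_append]
    exact fun q x y h => hle q ⟨x, y, h, rfl⟩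
  have hclosure (q) : closure (f.gfp q) ⊆ unitSquare :=
    closure_minimal (hsq q) isCompact_unitSquare.isClosed
  have hcompact (q) : IsCompact (closure (f.gfp q)) :=
    isCompact_unitSquare.of_isClosed_subset isClosed_closure (hclosure q)
  have hclosed (q) : closure (f.gfp q) = f.gfp q := by
    refine subset_antisymm ?_ subset_closure
    have hle : (fun q => closure (f.gfp q)) ≤ f.gfp := by
      refine f.le_gfp fun q => Set.subset_inter (hclosure q) ?_
      refine closure_minimal ?_ (isCompact_hutchinson hcompact q).isClosed
      have h := (hutchinson E).monotone
        (show f.gfp ≤ fun q => closure (f.gfp q) from fun q => subset_closure) q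
      rwa [← hfix] at h
    exact hle q
  refine ⟨f.gfp, isGifsAttractor_iff.2 ⟨fun q => ⟨?_, hclosed q ▸ hcompact q⟩, hfix⟩, hmem⟩
  obtain ⟨x, y, h⟩ := hne q
  exact ⟨_, hmem q x y h⟩

theorem interior_nonempty_of_unitSquare_subset {Z : Set (EuclideanSpace ℝ (Fin 2))}
    (h : unitSquare ⊆ Z) : (interior Z).Nonempty := by
  refine ⟨!₂[1 / 2, 1 / 2], mem_interior.2
    ⟨{p | ∀ i, p i ∈ Set.Ioo (0 : ℝ) 1}, fun p hp => h fun i => Set.Ioo_subset_Icc_self (hp i),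
      ?_, fun i => ?_⟩⟩
  · simp only [Set.ofPred_forall]
    refine isOpen_iInter_of_finite fun i => isOpen_Ioo.preimage ?_
    fun_prop
  · fin_cases i <;> norm_num

theorem attractor_subset_unitSquare [Nontrivial X] [Nontrivial Y] {E : List (TapeEdge X Y)}
    (hE : ∀ e ∈ E, e.2.2.2 ≠ []) {Z : Fin 3 → Set (EuclideanSpace ℝ (Fin 2))}
    (hZ : IsGifsAttractor (E.map TapeEdge.toGifs) Z) (q : Fin 3) : Z q ⊆ unitSquare := by
  obtain ⟨hc, hfix⟩ := isGifsAttractor_iff.1 hZ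
  have hbd : Bornology.IsBounded (⋃ q, Z q) := by
    rw [Bornology.isBounded_iUnion]
    exact fun q => (hc q).2.isBounded
  obtain ⟨c, hcpos, hball⟩ := hbd.exists_pos_norm_le
  have key (n : ℕ) : ∀ q, ∀ p ∈ Z q, ∀ i, -(c / 2 ^ n) ≤ p i ∧ p i ≤ 1 + c / 2 ^ n := by
    induction n with
    | zero =>
      intro q p hp i
      have h1 := (PiLp.norm_apply_le p i).trans (hball p (Set.mem_iUnion.2 ⟨q, hp⟩))
      rw [Real.norm_eq_abs, abs_le] at h1
      constructor <;> simp <;> linarith [h1.1, h1.2]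
    | succ n ih =>
      intro q p hp
      rw [hfix] at hp
      obtain ⟨e, he, rfl, p', hp', rfl⟩ := mem_hutchinson.1 hp
      have hpos : 0 ≤ c / 2 ^ n := by positivity
      rw [Fin.forall_fin_two]
      have h0 := ih _ p' hp' 0
      have h1 := ih _ p' hp' 1
      have h2 : c / 2 ^ (n + 1) = c / 2 ^ n / 2 := by rw [pow_succ, div_div]
      rw [e.map_zero, e.map_one]
      simp only [h2]
      exact ⟨⟨le_letterMap hpos h0.1 _, letterMap_le hpos h0.2 _⟩,
        le_wordMap hpos h1.1 (hE e he), wordMap_le hpos h1.2 (hE e he)⟩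
  have hlim : Filter.Tendsto (fun n : ℕ => c / 2 ^ n) Filter.atTop (nhds 0) :=
    tendsto_const_nhds.div_atTop (tendsto_pow_atTop_atTop_of_one_lt (by norm_num))
  intro p hp i
  constructor
  · have := hlim.neg
    rw [neg_zero] at this
    exact le_of_tendsto' this fun n => (key n q p hp i).1
  · have := hlim.const_add 1
    rw [add_zero] at this
    exact ge_of_tendsto' this fun n => (key n q p hp i).2

/-- Every run from `q` that starts with the tapes `s` and `t` dies before leaving them. -/
inductive Kill (E : List (TapeEdge X Y)) : Fin 3 → List X → List Y → Prop
  | step (q : Fin 3) (a : X) (s : List X) (t : List Y)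
      (hlen : ∀ r b, (q, r, a, b) ∈ E → t <+: b → b.length ≤ t.length)
      (h : ∀ r b, (q, r, a, b) ∈ E → ∀ t', t = b ++ t' → Kill E r s t') :
      Kill E q (a :: s) t

theorem Kill.notMem [Nontrivial X] [Nontrivial Y] {E : List (TapeEdge X Y)}
    (hE : ∀ e ∈ E, e.2.2.2 ≠ []) {Z : Fin 3 → Set (EuclideanSpace ℝ (Fin 2))}
    (hZ : IsGifsAttractor (E.map TapeEdge.toGifs) Z) {q : Fin 3} {s : List X} {t : List Y}
    (h : Kill E q s t) {u v : ℝ} (hu : u ∈ Set.Ioo (0 : ℝ) 1) (hv : v ∈ Set.Ioo (0 : ℝ) 1) :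
    !₂[wordMap s u, wordMap t v] ∉ Z q := by
  have hsq := attractor_subset_unitSquare hE hZ
  have hfix := (isGifsAttractor_iff.1 hZ).2
  induction h with
  | step q a s t hlen h ih =>
    intro hmem
    rw [hfix] at hmem
    obtain ⟨⟨q', r, a', b⟩, he, rfl, p, hp, heq⟩ := mem_hutchinson.1 hmem
    have h0 := congrArg (fun p => p 0) heq
    have h1 := congrArg (fun p => p 1) heq
    simp only [TapeEdge.map_zero, TapeEdge.map_one] at h0 h1
    obtain ⟨rfl, h0'⟩ := letterMap_injective (hsq _ hp 0) (wordMap_mem_Ioo hu s) h0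
    obtain ⟨t', rfl, h1'⟩ := exists_append_of_wordMap_eq (hsq _ hp 1) hv (hlen r b he) h1
    refine ih r b he t' rfl ?_
    convert hp using 1
    ext i
    fin_cases i
    · exact h0'.symm
    · exact h1'.symm

theorem interior_eq_empty_of_kill [Nontrivial X] [Nontrivial Y] {E : List (TapeEdge X Y)}
    (hE : ∀ e ∈ E, e.2.2.2 ≠ []) {Z : Fin 3 → Set (EuclideanSpace ℝ (Fin 2))}
    (hZ : IsGifsAttractor (E.map TapeEdge.toGifs) Z) {q : Fin 3}
    (h : ∀ s t, ∃ σ τ, Kill E q (s ++ σ) (t ++ τ)) : interior (Z q) = ∅ := by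
  rw [Set.eq_empty_iff_forall_notMem]
  intro p hp
  have hpsq := attractor_subset_unitSquare hE hZ q (interior_subset hp)
  obtain ⟨ε, hε, hball⟩ := Metric.isOpen_iff.1 isOpen_interior p hp
  obtain ⟨s, hs⟩ := exists_wordMap_near (X := X) (hpsq 0) (half_pos hε)
  obtain ⟨t, ht⟩ := exists_wordMap_near (X := Y) (hpsq 1) (half_pos hε)
  obtain ⟨σ, τ, hk⟩ := h s t
  have hhalf : (1 / 2 : ℝ) ∈ Set.Ioo (0 : ℝ) 1 := by norm_num
  refine hk.notMem hE hZ hhalf hhalf (interior_subset (hball ?_))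
  rw [wordMap_append, wordMap_append]
  have h0 := hs _ (wordMap_mem_Icc (Set.Ioo_subset_Icc_self hhalf) σ)
  have h1 := ht _ (wordMap_mem_Icc (Set.Ioo_subset_Icc_self hhalf) τ)
  rw [Metric.mem_ball, EuclideanSpace.dist_eq, Real.sqrt_lt' hε]
  simp only [Fin.sum_univ_two, Real.dist_eq]
  have h0' := pow_lt_pow_left₀ h0 (abs_nonneg _) two_ne_zero
  have h1' := pow_lt_pow_left₀ h1 (abs_nonneg _) two_ne_zero
  simp only [Matrix.cons_val_zero, Matrix.cons_val_one]
  nlinarith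

end Gifs

/-! ### The automaton of a modified Post correspondence problem -/

section Correspondence

/-- Embedding of words into words over the alphabet with a blank `none` and a marker
`some none`. -/
def embedWord {α : Type} (w : List α) : List (Option (Option α)) :=
  w.map fun a => some (some a)

@[simp] theorem embedWord_nil {α : Type} : embedWord ([] : List α) = [] := rfl

@[simp] theorem embedWord_cons {α : Type} (a : α) (w : List α) :
    embedWord (a :: w) = some (some a) :: embedWord w := rfl

@[simp] theorem embedWord_append {α : Type} (w z : List α) :
    embedWord (w ++ z) = embedWord w ++ embedWord z := by
  simp [embedWord]

@[simp] theorem length_embedWord {α : Type} (w : List α) :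
    (embedWord w).length = w.length := by
  simp [embedWord]

theorem embedWord_append_stream_inj {α : Type} {w w' : List α}
    {x x' : Stream' (Option (Option α))}
    (h : embedWord w ++ₛ Stream'.cons none x = embedWord w' ++ₛ Stream'.cons none x') :
    w = w' := by
  induction w generalizing w' with
  | nil =>
    cases w' with
    | nil => rfl
    | cons a w' => exact absurd (congrArg Stream'.head h) (by simp)
  | cons a w ih =>
    cases w' with
    | nil => exact absurd (congrArg Stream'.head h) (by simp)
    | cons a' w' =>
      simp only [embedWord_cons, Stream'.cons_append_stream] at h
      obtain ⟨h1, h2⟩ := Stream'.cons_injective2 h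
      rw [ih h2, Option.some.inj (Option.some.inj h1)]

variable {Y : Type} [Fintype Y] [DecidableEq Y]

/-- The minimal words that are not compatible with `w`. -/
noncomputable def mismatches : List Y → List (List Y)
  | [] => []
  | a :: w => ((Finset.univ.filter (· ≠ a)).toList.map fun b => [b]) ++
      (mismatches w).map (a :: ·)

theorem ne_nil_of_mem_mismatches {c w : List Y} (h : c ∈ mismatches w) : c ≠ [] := by
  cases w with
  | nil => simp [mismatches] at h
  | cons a w =>
    rintro rfl
    simp [mismatches] at h

theorem not_prefix_of_mem_mismatches {c w : List Y} (h : c ∈ mismatches w) (z : List Y) :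
    ¬ c <+: w ++ z := by
  induction w generalizing c with
  | nil => simp [mismatches] at h
  | cons a w ih =>
    simp only [mismatches, List.mem_append, List.mem_map, Finset.mem_toList, Finset.mem_filter,
      Finset.mem_univ, true_and] at h
    obtain ⟨b, hb, rfl⟩ | ⟨c, hc, rfl⟩ := h
    · simpa using hb
    · simpa using ih hc

theorem length_le_of_mem_mismatches {c w : List Y} (h : c ∈ mismatches w) :
    c.length ≤ w.length := by
  induction w generalizing c with
  | nil => simp [mismatches] at h
  | cons a w ih =>
    simp only [mismatches, List.mem_append, List.mem_map] at h
    obtain ⟨b, hb, rfl⟩ | ⟨c, hc, rfl⟩ := h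
    · simp
    · simpa using ih hc

theorem exists_append_or_mismatch (w : List Y) (y : Stream' Y) :
    (∃ y', y = w ++ₛ y') ∨ ∃ c ∈ mismatches w, ∃ y', y = c ++ₛ y' := by
  induction w generalizing y with
  | nil => exact Or.inl ⟨y, rfl⟩
  | cons a w ih =>
    by_cases ha : y.head = a
    · obtain ⟨y', hy⟩ | ⟨c, hc, y', hy⟩ := ih y.tail
      · refine Or.inl ⟨y', ?_⟩
        rw [Stream'.cons_append_stream, ← hy, ← ha, Stream'.eta]
      · refine Or.inr ⟨a :: c, by simp [mismatches, hc], y', ?_⟩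
        rw [Stream'.cons_append_stream, ← hy, ← ha, Stream'.eta]
    · refine Or.inr ⟨[y.head], by simp [mismatches, ha], y.tail, ?_⟩
      rw [Stream'.cons_append_stream, Stream'.nil_append_stream, Stream'.eta]

variable {I A : Type} [Fintype I] [Fintype A] [DecidableEq A]

/-- The edges through the state `q` that verify, after a marker, that the second tape starts
with `s` followed by the `t`-image of the first tape, and that allow escaping to the state `0`
as soon as this fails. -/
noncomputable def branchEdges (q : Fin 3) (s : List A) (t : I → List A) :
    List (TapeEdge (Option (Option I)) (Option (Option A))) :=
  ((0, q, some none, some none :: embedWord s) ::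
    (mismatches (embedWord s)).map fun c => (0, 0, some none, some none :: c)) ++
  (Finset.univ.toList.flatMap fun i => (q, q, some (some i), embedWord (t i)) ::
    (mismatches (embedWord (t i))).map fun c => (q, 0, some (some i), c)) ++
  ((Finset.univ.filter (· ≠ none)).toList.map fun b => (q, 0, none, [b])) ++
  Finset.univ.toList.map fun b => (q, 0, some none, [b])

theorem mem_branchEdges {q : Fin 3} {s : List A} {t : I → List A}
    {e : TapeEdge (Option (Option I)) (Option (Option A))} :
    e ∈ branchEdges q s t ↔
      e = (0, q, some none, some none :: embedWord s) ∨
      (∃ c ∈ mismatches (embedWord s), e = (0, 0, some none, some none :: c)) ∨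
      (∃ i, e = (q, q, some (some i), embedWord (t i))) ∨
      (∃ i, ∃ c ∈ mismatches (embedWord (t i)), e = (q, 0, some (some i), c)) ∨
      (∃ b, b ≠ none ∧ e = (q, 0, none, [b])) ∨
      ∃ b, e = (q, 0, some none, [b]) := by
  simp only [branchEdges, List.mem_append, List.mem_cons, List.mem_map, List.mem_flatMap,
    Finset.mem_toList, Finset.mem_univ, true_and, Finset.mem_filter, exists_or, or_assoc,
    eq_comm (b := e)]

/-- The two tapes start with a blank-terminated word and its blank-terminated `t`-image. -/
def Matched (t : I → List A) (x : Stream' (Option (Option I)))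
    (y : Stream' (Option (Option A))) : Prop :=
  ∃ (w : List I) (x' : Stream' (Option (Option I))) (y' : Stream' (Option (Option A))),
    x = embedWord w ++ₛ Stream'.cons none x' ∧
    y = embedWord (w.flatMap t) ++ₛ Stream'.cons none y'

theorem exists_branchEdge (q : Fin 3) (s : List A) (t : I → List A)
    {x : Stream' (Option (Option I))} {y : Stream' (Option (Option A))}
    (h : ¬ Matched t x y) :
    ∃ r a b, (q, r, a, b) ∈ branchEdges q s t ∧ ∃ x' y', x = Stream'.cons a x' ∧
      y = b ++ₛ y' ∧ (r = 0 ∨ r = q ∧ ¬ Matched t x' y') := by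
  obtain ⟨a, x, rfl⟩ : ∃ a x', x = Stream'.cons a x' := ⟨_, _, (Stream'.eta x).symm⟩
  rcases a with _ | _ | i
  · obtain ⟨b, y, rfl⟩ : ∃ b y', y = Stream'.cons b y' := ⟨_, _, (Stream'.eta y).symm⟩
    refine ⟨0, none, [b], mem_branchEdges.2 ?_, x, y, rfl, rfl, Or.inl rfl⟩
    have hb : b ≠ none := by
      rintro rfl
      exact h ⟨[], x, y, rfl, rfl⟩
    simp [hb]
  · obtain ⟨b, y, rfl⟩ : ∃ b y', y = Stream'.cons b y' := ⟨_, _, (Stream'.eta y).symm⟩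
    exact ⟨0, some none, [b], mem_branchEdges.2 (by simp), x, y, rfl, rfl, Or.inl rfl⟩
  · obtain ⟨y, rfl⟩ | ⟨c, hc, y, rfl⟩ := exists_append_or_mismatch (embedWord (t i)) y
    · refine ⟨q, some (some i), embedWord (t i), mem_branchEdges.2 (by simp), x, y, rfl, rfl,
        Or.inr ⟨rfl, ?_⟩⟩
      rintro ⟨w, x, y, rfl, rfl⟩
      exact h ⟨i :: w, x, y, rfl, by simp [Stream'.append_append_stream]⟩
    · exact ⟨0, some (some i), c, mem_branchEdges.2 (by simp [hc]), x, y, rfl, rfl,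
        Or.inl rfl⟩

variable [DecidableEq I]

/-- The automaton recognising the absence of solutions of the correspondence problem with
start word `u₀` and tiles `(u i, v i)`. -/
noncomputable def tapeEdges (u₀ : List A) (u v : I → List A) :
    List (TapeEdge (Option (Option I)) (Option (Option A))) :=
  (Finset.univ.toList.flatMap fun a => Finset.univ.toList.flatMap fun b =>
    if a = some none ∧ b = some none then [] else [(0, 0, a, [b])]) ++
  (branchEdges 1 u₀ u ++ branchEdges 2 [] v)

theorem mem_tapeEdges {u₀ : List A} {u v : I → List A}
    {e : TapeEdge (Option (Option I)) (Option (Option A))} :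
    e ∈ tapeEdges u₀ u v ↔
      (∃ a b, ¬ (a = some none ∧ b = some none) ∧ e = (0, 0, a, [b])) ∨
      e ∈ branchEdges 1 u₀ u ∨ e ∈ branchEdges 2 [] v := by
  have h (a : Option (Option I)) (b : Option (Option A)) :
      (e ∈ if a = some none ∧ b = some none then [] else
        [((0 : Fin 3), (0 : Fin 3), a, [b])]) ↔
      ¬ (a = some none ∧ b = some none) ∧ e = (0, 0, a, [b]) := by
    split_ifs with h <;> simp [h]
  simp only [tapeEdges, List.mem_append, List.mem_flatMap, Finset.mem_toList, Finset.mem_univ,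
    true_and, h]

variable {u₀ : List A} {u v : I → List A}

theorem tapeEdges_ne_nil (hu : ∀ i, u i ≠ []) (hv : ∀ i, v i ≠ []) :
    ∀ e ∈ tapeEdges u₀ u v, e.2.2.2 ≠ [] := by
  have hb (q : Fin 3) (s : List A) (t : I → List A) (ht : ∀ i, t i ≠ []) :
      ∀ e ∈ branchEdges q s t, e.2.2.2 ≠ [] := by
    intro e he
    obtain rfl | ⟨c, hc, rfl⟩ | ⟨i, rfl⟩ | ⟨i, c, hc, rfl⟩ | ⟨b, -, rfl⟩ | ⟨b, rfl⟩ :=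
      mem_branchEdges.1 he
    · simp
    · simp
    · simpa [embedWord] using ht i
    · exact ne_nil_of_mem_mismatches hc
    · simp
    · simp
  intro e he
  obtain ⟨a, b, -, rfl⟩ | he | he := mem_tapeEdges.1 he
  · simp
  · exact hb _ _ _ hu e he
  · exact hb _ _ _ hv e he

theorem exists_mem_tapeEdges (u₀ : List A) (u v : I → List A) (q : Fin 3) :
    ∃ e ∈ tapeEdges u₀ u v, e.1 = q := by
  fin_cases q
  · exact ⟨(0, 0, none, [none]), mem_tapeEdges.2 (Or.inl ⟨_, _, by simp, rfl⟩), rfl⟩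
  · exact ⟨(1, 0, some none, [none]), mem_tapeEdges.2 (Or.inr (Or.inl
      (mem_branchEdges.2 (by simp)))), rfl⟩
  · exact ⟨(2, 0, some none, [none]), mem_tapeEdges.2 (Or.inr (Or.inr
      (mem_branchEdges.2 (by simp)))), rfl⟩

theorem exists_isGifsAttractor_of_forall_ne [Nonempty I] [Nonempty A]
    (h : ∀ w : List I, u₀ ++ w.flatMap u ≠ w.flatMap v) :
    ∃ Z, IsGifsAttractor ((tapeEdges u₀ u v).map TapeEdge.toGifs) Z ∧ unitSquare ⊆ Z 0 := by
  let P : Fin 3 → Stream' (Option (Option I)) → Stream' (Option (Option A)) → Prop :=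
    fun q x y => (q = 1 → ¬ Matched u x y) ∧ (q = 2 → ¬ Matched v x y)
  have hne : ∀ q, ∃ x y, P q x y := by
    have hm (t : I → List A) : ¬ Matched t (Stream'.const (some none)) (Stream'.const none) := by
      rintro ⟨w, x, y, hx, -⟩
      have := congrArg Stream'.head hx
      cases w <;> simp [Stream'.head] at this
    exact fun q => ⟨_, _, fun _ => hm u, fun _ => hm v⟩
  have hstep : ∀ q x y, P q x y → ∃ r a b, (q, r, a, b) ∈ tapeEdges u₀ u v ∧
      ∃ x' y', x = Stream'.cons a x' ∧ y = b ++ₛ y' ∧ P r x' y' := by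
    intro q x y hP
    fin_cases q
    · obtain ⟨a, x, rfl⟩ : ∃ a x', x = Stream'.cons a x' := ⟨_, _, (Stream'.eta x).symm⟩
      obtain ⟨b, y, rfl⟩ : ∃ b y', y = Stream'.cons b y' := ⟨_, _, (Stream'.eta y).symm⟩
      by_cases hab : a = some none ∧ b = some none
      · obtain ⟨rfl, rfl⟩ := hab
        obtain ⟨y, rfl⟩ | ⟨c, hc, y, rfl⟩ := exists_append_or_mismatch (embedWord u₀) y
        · by_cases hu : Matched u x y
          · refine ⟨2, _, [some none], mem_tapeEdges.2 (Or.inr (Or.inr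
              (mem_branchEdges.2 (by simp)))), x, _, rfl, rfl, by simp, fun _ hv => ?_⟩
            obtain ⟨w, x, y, rfl, rfl⟩ := hu
            obtain ⟨w', x', y', hx, hy⟩ := hv
            obtain rfl := embedWord_append_stream_inj hx
            rw [← Stream'.append_append_stream, ← embedWord_append] at hy
            exact h w (embedWord_append_stream_inj hy)
          · exact ⟨1, _, some none :: embedWord u₀, mem_tapeEdges.2 (Or.inr (Or.inl
              (mem_branchEdges.2 (by simp)))), x, y, rfl, rfl, fun _ => hu, by simp⟩
        · exact ⟨0, _, some none :: c, mem_tapeEdges.2 (Or.inr (Or.inl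
            (mem_branchEdges.2 (by simp [hc])))), x, y, rfl, rfl, by simp, by simp⟩
      · exact ⟨0, a, [b], mem_tapeEdges.2 (Or.inl ⟨a, b, hab, rfl⟩), x, y, rfl, rfl,
          by simp, by simp⟩
    · obtain ⟨r, a, b, he, x', y', hx, hy, hr⟩ := exists_branchEdge 1 u₀ u (hP.1 rfl)
      refine ⟨r, a, b, mem_tapeEdges.2 (Or.inr (Or.inl he)), x', y', hx, hy, ?_⟩
      rcases hr with rfl | ⟨rfl, hr⟩
      · exact ⟨by simp, by simp⟩
      · exact ⟨fun _ => hr, by simp⟩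
    · obtain ⟨r, a, b, he, x', y', hx, hy, hr⟩ := exists_branchEdge 2 [] v (hP.2 rfl)
      refine ⟨r, a, b, mem_tapeEdges.2 (Or.inr (Or.inr he)), x', y', hx, hy, ?_⟩
      rcases hr with rfl | ⟨rfl, hr⟩
      · exact ⟨by simp, by simp⟩
      · exact ⟨by simp, fun _ => hr⟩
  obtain ⟨Z, hZ, hPZ⟩ := exists_isGifsAttractor hne hstep
  refine ⟨Z, hZ, fun p hp => ?_⟩
  obtain ⟨x, hx⟩ := exists_streamVal_eq (X := Option (Option I)) (hp 0)
  obtain ⟨y, hy⟩ := exists_streamVal_eq (X := Option (Option A)) (hp 1)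
  convert hPZ 0 x y ⟨by simp, by simp⟩ using 1
  ext i
  fin_cases i
  · exact hx.symm
  · exact hy.symm

theorem kill_zero_cons {a : Option (Option I)} {b : Option (Option A)}
    (hab : ¬ (a = some none ∧ b = some none)) {s : List (Option (Option I))}
    {t : List (Option (Option A))} (h : Kill (tapeEdges u₀ u v) 0 s t) :
    Kill (tapeEdges u₀ u v) 0 (a :: s) (b :: t) := by
  have key : ∀ r c, (0, r, a, c) ∈ tapeEdges u₀ u v →
      r = 0 ∧ (∃ b', c = [b']) ∨ a = some none ∧ ∃ c', c = some none :: c' := by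
    intro r c he
    simp [mem_tapeEdges, mem_branchEdges] at he
    aesop
  constructor
  · intro r c he hp
    obtain ⟨-, b', rfl⟩ | ⟨rfl, c', rfl⟩ := key r c he
    · simp
    · exact absurd ⟨rfl, (List.cons_prefix_cons.1 hp).1⟩ hab
  · intro r c he t' ht
    obtain ⟨rfl, b', rfl⟩ | ⟨rfl, c', rfl⟩ := key r c he
    · obtain ⟨-, rfl⟩ := List.cons.inj ht
      exact h
    · exact absurd ⟨rfl, (List.cons.inj ht).1⟩ hab

theorem kill_zero_append {z : List (Option (Option I))} (hz : ∀ a ∈ z, a ≠ some none)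
    {s : List (Option (Option I))} {t : List (Option (Option A))} (hlen : z.length ≤ t.length)
    (h : Kill (tapeEdges u₀ u v) 0 s (t.drop z.length)) :
    Kill (tapeEdges u₀ u v) 0 (z ++ s) t := by
  induction z generalizing t with
  | nil => simpa using h
  | cons a z ih =>
    cases t with
    | nil => simp at hlen
    | cons b t =>
      exact kill_zero_cons (fun h => hz a (by simp) h.1)
        (ih (fun a ha => hz a (by simp [ha])) (by simpa using hlen) (by simpa using h))

theorem kill_none {q : Fin 3} (hq : q ≠ 0) (s : List (Option (Option I)))
    (t : List (Option (Option A))) :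
    Kill (tapeEdges u₀ u v) q (none :: s) (none :: t) := by
  have key : ∀ r c, (q, r, none, c) ∈ tapeEdges u₀ u v → ∃ b, b ≠ none ∧ c = [b] := by
    intro r c he
    simp [mem_tapeEdges, mem_branchEdges, hq] at he
    aesop
  constructor
  · intro r c he hp
    obtain ⟨b, hb, rfl⟩ := key r c he
    simp
  · intro r c he t' ht
    obtain ⟨b, hb, rfl⟩ := key r c he
    exact absurd (List.cons.inj ht).1.symm hb

theorem kill_embedWord {q : Fin 3} {p : List A} {tile : I → List A}
    (hq : q = 1 ∧ p = u₀ ∧ tile = u ∨ q = 2 ∧ p = [] ∧ tile = v) (w : List I)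
    (s : List (Option (Option I))) (t : List (Option (Option A))) :
    Kill (tapeEdges u₀ u v) q (embedWord w ++ none :: s)
      (embedWord (w.flatMap tile) ++ none :: t) := by
  induction w with
  | nil => exact kill_none (by rcases hq with h | h <;> simp [h.1]) s t
  | cons i w ih =>
    have key : ∀ r c, (q, r, some (some i), c) ∈ tapeEdges u₀ u v →
        r = q ∧ c = embedWord (tile i) ∨ c ∈ mismatches (embedWord (tile i)) := by
      intro r c he
      rcases hq with ⟨rfl, rfl, rfl⟩ | ⟨rfl, rfl, rfl⟩ <;>
      · simp [mem_tapeEdges, mem_branchEdges] at he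
        aesop
    rw [List.flatMap_cons, embedWord_append, List.append_assoc, embedWord_cons, List.cons_append]
    constructor
    · intro r c he hp
      obtain ⟨rfl, rfl⟩ | hc := key r c he
      · simp
      · exact (length_le_of_mem_mismatches hc).trans (by simp)
    · intro r c he t' ht
      obtain ⟨rfl, rfl⟩ | hc := key r c he
      · obtain rfl := List.append_cancel_left ht
        exact ih
      · exact absurd ⟨t', ht.symm⟩ (not_prefix_of_mem_mismatches hc _)

theorem kill_marker {w : List I} (hw : u₀ ++ w.flatMap u = w.flatMap v)
    (s : List (Option (Option I))) (t : List (Option (Option A))) :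
    Kill (tapeEdges u₀ u v) 0 (some none :: (embedWord w ++ none :: s))
      (some none :: (embedWord (w.flatMap v) ++ none :: t)) := by
  have key : ∀ r c, (0, r, some none, c) ∈ tapeEdges u₀ u v →
      (∃ b, b ≠ some none ∧ c = [b]) ∨ (r = 1 ∧ c = some none :: embedWord u₀) ∨
      (∃ c' ∈ mismatches (embedWord u₀), c = some none :: c') ∨ r = 2 ∧ c = [some none] := by
    intro r c he
    simp [mem_tapeEdges, mem_branchEdges, mismatches] at he
    aesop
  have hw' : embedWord (w.flatMap v) ++ none :: t =
      embedWord u₀ ++ (embedWord (w.flatMap u) ++ none :: t) := by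
    rw [← hw, embedWord_append, List.append_assoc]
  constructor
  · intro r c he hp
    obtain ⟨b, hb, rfl⟩ | ⟨rfl, rfl⟩ | ⟨c', hc, rfl⟩ | ⟨rfl, rfl⟩ := key r c he
    · simp
    · rw [hw']
      simp
    · rw [hw']
      have := length_le_of_mem_mismatches hc
      simp at this ⊢
      omega
    · simp
  · intro r c he t' ht
    obtain ⟨b, hb, rfl⟩ | ⟨rfl, rfl⟩ | ⟨c', hc, rfl⟩ | ⟨rfl, rfl⟩ := key r c he
    · exact absurd (List.cons.inj ht).1.symm hb
    · rw [hw', List.cons_append] at ht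
      obtain rfl := List.append_cancel_left (List.cons.inj ht).2
      exact kill_embedWord (Or.inl ⟨rfl, rfl, rfl⟩) w s t
    · rw [hw'] at ht
      exact absurd ⟨t', (List.cons.inj ht).2.symm⟩ (not_prefix_of_mem_mismatches hc _)
    · obtain rfl := (List.cons.inj ht).2
      exact kill_embedWord (Or.inr ⟨rfl, rfl, rfl⟩) w s t

theorem exists_kill_drop {w : List I} (hw : u₀ ++ w.flatMap u = w.flatMap v) (L : ℕ) :
    ∃ (σ : List (Option (Option I))) (τ : List (Option (Option A))),
      L ≤ τ.length ∧ ∀ o < L, Kill (tapeEdges u₀ u v) 0 σ (τ.drop o) := by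
  induction L with
  | zero => exact ⟨[], [], by simp, by simp⟩
  | succ L ih =>
    obtain ⟨σ, τ, hτ, hk⟩ := ih
    set z := w.flatMap v with hz
    refine ⟨some none :: (embedWord w ++ none :: (List.replicate (L + z.length) none ++ σ)),
      List.replicate L none ++
        some none :: (embedWord z ++ none :: (List.replicate w.length none ++ τ)),
      by simp, fun o ho => ?_⟩
    rcases Nat.lt_succ_iff_lt_or_eq.1 ho with ho | rfl
    · obtain ⟨d, rfl⟩ : ∃ d, L = o + (d + 1) := ⟨L - o - 1, by omega⟩
      rw [List.drop_append_of_le_length (by simp), List.drop_replicate,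
        Nat.add_sub_cancel_left, List.replicate_succ, List.cons_append]
      refine kill_zero_cons (by simp) ?_
      have := kill_zero_append (u₀ := u₀) (u := u) (v := v)
        (z := embedWord w ++ none :: List.replicate (o + (d + 1) + z.length) none)
        (s := σ) (t := List.replicate d none ++ some none ::
          (embedWord z ++ none :: (List.replicate w.length none ++ τ))) ?_ ?_ ?_
      · simpa using this
      · simp only [embedWord, List.mem_append, List.mem_map, List.mem_cons, List.mem_replicate]
        rintro a (⟨i, -, rfl⟩ | rfl | ⟨-, rfl⟩) <;> simp
      · simp; omega
      · convert hk o ho using 1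
        have h := List.drop_length_add_append (l₁ := List.replicate d none ++ some none ::
          (embedWord z ++ none :: List.replicate w.length none)) (l₂ := τ) o
        rw [← h]
        congr 1
        · simp; omega
        · simp
    · rw [List.drop_left' (by simp)]
      exact kill_marker hw _ _

/-- Every run reads a word of length `n` on the first tape together with a word of length
between `n` and `K * n` on the second. -/
theorem kill_append {K : ℕ} (hu : ∀ i, u i ≠ []) (hv : ∀ i, v i ≠ [])
    (hK : ∀ e ∈ tapeEdges u₀ u v, e.2.2.2.length ≤ K) {σ : List (Option (Option I))}
    (s : List (Option (Option I))) (q : Fin 3) (t : List (Option (Option A)))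
    (ht : K * s.length ≤ t.length)
    (h : ∀ q c, s.length ≤ c → c ≤ K * s.length → Kill (tapeEdges u₀ u v) q σ (t.drop c)) :
    Kill (tapeEdges u₀ u v) q (s ++ σ) t := by
  induction s generalizing q t with
  | nil => simpa using h q 0 (by simp) (by simp)
  | cons a s ih =>
    rw [List.length_cons, mul_add, mul_one] at ht
    constructor
    · intro r b he _
      exact (hK _ he).trans (by omega)
    · rintro r b he t rfl
      have hb : b.length ≤ K := hK _ he
      have hb' : 0 < b.length := List.length_pos_iff.2 (tapeEdges_ne_nil hu hv _ he)
      rw [List.length_append] at ht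
      refine ih r t (by omega) fun q c h1 h2 => ?_
      have := h q (b.length + c) (by simp; omega) (by simp [mul_add]; omega)
      rwa [List.drop_length_add_append] at this

theorem exists_kill (hu : ∀ i, u i ≠ []) (hv : ∀ i, v i ≠ []) {w : List I}
    (hw : u₀ ++ w.flatMap u = w.flatMap v) (s : List (Option (Option I)))
    (t : List (Option (Option A))) :
    ∃ σ τ, Kill (tapeEdges u₀ u v) 0 (s ++ σ) (t ++ τ) := by
  obtain ⟨K, hK⟩ : ∃ K, ∀ e ∈ tapeEdges u₀ u v, e.2.2.2.length ≤ K := by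
    obtain ⟨K, hK⟩ := ((List.finite_toSet (tapeEdges u₀ u v)).image
      fun e => e.2.2.2.length).bddAbove
    exact ⟨K, fun e he => hK ⟨e, he, rfl⟩⟩
  set n := s.length + t.length with hn
  obtain ⟨σ, τ, hτ, hk⟩ := exists_kill_drop hw (K * n + 1)
  refine ⟨List.replicate t.length none ++ (List.replicate (K * n + 1) none ++ σ),
    List.replicate (s.length + (K * n + 1)) none ++ τ, ?_⟩
  rw [← List.append_assoc]
  refine kill_append hu hv hK _ _ _ (by simp [← hn]; omega) fun q c h1 h2 => ?_
  simp only [List.length_append, List.length_replicate, ← hn] at h1 h2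
  obtain ⟨d, hd⟩ : ∃ d, s.length + (K * n + 1) = c - t.length + (d + 1) :=
    ⟨s.length + (K * n + 1) - (c - t.length) - 1, by omega⟩
  have hdrop : (t ++ (List.replicate (s.length + (K * n + 1)) none ++ τ)).drop c =
      List.replicate (d + 1) none ++ τ := by
    obtain ⟨c', rfl⟩ : ∃ c', c = t.length + c' := ⟨c - t.length, by omega⟩
    rw [List.drop_length_add_append, List.drop_append_of_le_length (by simp; omega),
      List.drop_replicate]
    congr 2
    omega
  rw [hdrop]
  by_cases hq : q = 0
  · subst hq
    refine kill_zero_append (by simp) (by simp; omega) ?_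
    convert hk (c - n) (by omega) using 1
    have h := List.drop_length_add_append (l₁ := List.replicate (d + 1) none) (l₂ := τ) (c - n)
    rw [← h]
    congr 1
    simp
    omega
  · exact kill_none hq _ _

theorem interior_eq_empty_of_exists_eq [Nonempty I] [Nonempty A]
    (hu : ∀ i, u i ≠ []) (hv : ∀ i, v i ≠ []) {w : List I}
    (hw : u₀ ++ w.flatMap u = w.flatMap v) {Z : Fin 3 → Set (EuclideanSpace ℝ (Fin 2))}
    (hZ : IsGifsAttractor ((tapeEdges u₀ u v).map TapeEdge.toGifs) Z) : interior (Z 0) = ∅ :=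
  interior_eq_empty_of_kill (tapeEdges_ne_nil hu hv) hZ (exists_kill hu hv hw)

end Correspondence

/-! ### Primitive recursive rational arithmetic -/

section RationalArithmetic

open Encodable

theorem primrec_nat_gcd : Primrec₂ Nat.gcd := by
  have hdvd : ∀ {f g : (ℕ × ℕ) → ℕ → ℕ}, Primrec₂ f → Primrec₂ g →
      PrimrecRel fun p k => f p k ∣ g p k := fun hf hg =>
    PrimrecRel.of_eq (r := fun p k => _ % _ = 0)
      (Primrec.eq.comp₂ (Primrec.nat_mod.comp₂ hg hf) (Primrec₂.const 0))
      fun _ _ => (Nat.dvd_iff_mod_eq_zero).symm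
  have h : Primrec fun p : ℕ × ℕ =>
      (p.1 + p.2).findGreatest fun k => k ∣ p.1 ∧ k ∣ p.2 :=
    Primrec.nat_findGreatest (Primrec.nat_add.comp Primrec.fst Primrec.snd)
      (PrimrecPred.and (hdvd .right (Primrec.fst.comp₂ .left))
        (hdvd .right (Primrec.snd.comp₂ .left)))
  suffices H : Primrec fun p : ℕ × ℕ => Nat.gcd p.1 p.2 from H
  refine h.of_eq fun p => ?_
  rw [Nat.findGreatest_eq_iff]
  rcases Nat.eq_zero_or_pos (p.1 + p.2) with h0 | h0
  · have h1 : p.1 = 0 := by omega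
    have h2 : p.2 = 0 := by omega
    simp +contextual [h1, h2, Nat.pos_iff_ne_zero]
  have hpos : 0 < Nat.gcd p.1 p.2 := by
    rw [Nat.pos_iff_ne_zero, Ne, Nat.gcd_eq_zero_iff]; omega
  refine ⟨?_, fun _ => ⟨Nat.gcd_dvd_left _ _, Nat.gcd_dvd_right _ _⟩, ?_⟩
  · exact Nat.le_of_dvd h0 (Nat.dvd_add (Nat.gcd_dvd_left _ _) (Nat.gcd_dvd_right _ _))
  · rintro n hn - ⟨ha, hb⟩
    exact absurd (Nat.le_of_dvd hpos (Nat.dvd_gcd ha hb)) (by omega)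

theorem primrec_count {p : ℕ → Prop} [DecidablePred p] (hp : PrimrecPred p) :
    Primrec (Nat.count p) := by
  have h : Primrec₂ fun (n c : ℕ) => c + if p n then 1 else 0 :=
    Primrec.nat_add.comp₂ .right
      (Primrec.ite (hp.comp Primrec.fst) (Primrec.const 1) (Primrec.const 0))
  refine (Primrec.nat_rec₁ 0 h).of_eq fun n => ?_
  induction n with
  | zero => simp
  | succ n ih => simp [Nat.count_succ, ← ih]

theorem rat_encode_eq_count (x : ℚ) : @encode ℚ Primcodable.toEncodable x =
    Nat.count (fun m => 0 < m.unpair.2 ∧ ((m.unpair.1 + 1) / 2).gcd m.unpair.2 = 1)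
      (Nat.pair (encode x.num) x.den) := by
  let := @decidableRangeEncode ℚ Rat.instEncodable
  have habs (z : ℤ) : (encode z + 1) / 2 = z.natAbs := by
    rcases z with n | n
    · change (2 * n + 1) / 2 = n
      omega
    · change (2 * n + 1 + 1) / 2 = n + 1
      omega
  have h : @encode ℚ Primcodable.toEncodable x =
      Nat.count (· ∈ Set.range (@encode ℚ Rat.instEncodable))
        (Nat.pair (encode x.num) x.den) := rfl
  rw [h]
  simp only [Nat.count_eq_card_filter_range]
  congr 1
  ext m
  simp only [Finset.mem_filter, Set.mem_range]
  refine and_congr_right fun _ => ⟨?_, ?_⟩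
  · rintro ⟨q, rfl⟩
    have hq : @encode ℚ Rat.instEncodable q = Nat.pair (encode q.num) q.den := rfl
    rw [hq, Nat.unpair_pair, habs]
    exact ⟨q.pos, q.reduced⟩
  · rintro ⟨h2, h3⟩
    obtain ⟨z, hz⟩ : ∃ z : ℤ, encode z = m.unpair.1 :=
      ⟨Denumerable.ofNat ℤ _, Denumerable.encode_ofNat _⟩
    rw [← hz, habs] at h3
    refine ⟨⟨z, m.unpair.2, h2.ne', h3⟩, ?_⟩
    change Nat.pair (encode z) m.unpair.2 = m
    rw [hz, Nat.pair_unpair]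

theorem primrec_nat_div_rat : Primrec₂ fun a d : ℕ => (a : ℚ) / (d + 1 : ℕ) := by
  have hp : PrimrecPred fun m : ℕ =>
      0 < m.unpair.2 ∧ ((m.unpair.1 + 1) / 2).gcd m.unpair.2 = 1 := by
    have h2 : Primrec fun m : ℕ => m.unpair.2 := Primrec.snd.comp Primrec.unpair
    have h1 : Primrec fun m : ℕ => m.unpair.1 := Primrec.fst.comp Primrec.unpair
    exact (Primrec.nat_lt.comp (Primrec.const 0) h2).and
      (Primrec.eq.comp (primrec_nat_gcd.comp
        (Primrec.nat_div.comp (Primrec.nat_add.comp h1 (Primrec.const 1)) (Primrec.const 2)) h2)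
        (Primrec.const 1))
  have hs : Primrec₂ fun _ d : ℕ => d + 1 := Primrec.succ.comp₂ .right
  have hg : Primrec₂ fun a d : ℕ => a.gcd (d + 1) := primrec_nat_gcd.comp₂ .left hs
  have h := (primrec_count hp).comp₂ (Primrec₂.natPair.comp₂
    (Primrec.nat_mul.comp₂ (Primrec₂.const 2) (Primrec.nat_div.comp₂ .left hg))
    (Primrec.nat_div.comp₂ hs hg))
  rw [← Primrec₂.encode_iff]
  refine h.of_eq fun a d => ?_
  rw [rat_encode_eq_count]
  have hq : ((a : ℚ) / (d + 1 : ℕ)) = Rat.divInt a (d + 1 : ℕ) := by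
    rw [Rat.divInt_eq_div]; push_cast; rfl
  have hnat : ((d : ℤ) + 1).natAbs = d + 1 := by omega
  have hnum : ((a : ℚ) / (d + 1 : ℕ)).num = (a / a.gcd (d + 1) : ℕ) := by
    rw [hq, Rat.num_divInt]
    simp [Int.gcd, hnat, Nat.gcd_comm a]
  have hden : ((a : ℚ) / (d + 1 : ℕ)).den = (d + 1) / a.gcd (d + 1) := by
    rw [hq, Rat.den_divInt, if_neg (by omega)]
    simp [Int.gcd, hnat, Nat.gcd_comm a]
  rw [hnum, hden]
  rfl

end RationalArithmetic

/-! ### Primitive recursiveness of the automaton -/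

section Encoding

theorem primrec_nat_pow : Primrec₂ ((· ^ ·) : ℕ → ℕ → ℕ) :=
  Primrec₂.unpaired'.1 Nat.Primrec.pow

theorem primrec_rat_div_pow {α : Type} [Primcodable α] {f g : α → ℕ} (hf : Primrec f)
    (hg : Primrec g) {K : ℕ} (hK : K ≠ 0) : Primrec fun a => (f a : ℚ) / (K : ℚ) ^ g a := by
  refine (primrec_nat_div_rat.comp hf (Primrec.pred.comp
    (primrec_nat_pow.comp (Primrec.const K) hg))).of_eq fun a => ?_
  rw [Nat.pred_eq_sub_one, Nat.sub_add_cancel (Nat.pos_of_ne_zero (pow_ne_zero _ hK)),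
    Nat.cast_pow]

theorem primrec_embedWord {α : Type} [Primcodable α] : Primrec (embedWord (α := α)) :=
  Primrec.list_map .id (Primrec.option_some.comp (Primrec.option_some.comp .snd)).to₂

variable {X Y : Type} [Fintype X] [Fintype Y] [Primcodable X] [Primcodable Y]

theorem primrec_wordNum : Primrec (wordNum (X := X)) := by
  refine Primrec.list_foldl (h := fun (_ : List X) (p : ℕ × X) =>
    p.1 * Fintype.card X + (Fintype.equivFin X p.2 : ℕ)) .id (.const 0) ?_
  exact (Primrec.nat_add.comp
    (Primrec.nat_mul.comp (Primrec.fst.comp .snd) (.const _))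
    ((Primrec.dom_finite fun a : X => (Fintype.equivFin X a : ℕ)).comp
      (Primrec.snd.comp .snd))).to₂

theorem primrec_mismatches [DecidableEq Y] : Primrec (mismatches (Y := Y)) := by
  refine (Primrec.list_foldr (f := id) (g := fun _ => [])
    (h := fun (_ : List Y) (p : Y × List (List Y)) =>
      ((Finset.univ.filter (· ≠ p.1)).toList.map fun b => [b]) ++ p.2.map (p.1 :: ·))
    .id (.const _) ?_).of_eq fun w => ?_
  · have h1 : Primrec fun a : Y => (Finset.univ.filter (· ≠ a)).toList.map fun b => [b] :=
      Primrec.dom_finite _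
    exact (Primrec.list_append.comp (h1.comp (Primrec.fst.comp .snd))
      (Primrec.list_map (Primrec.snd.comp .snd)
        (Primrec.list_cons.comp (Primrec.fst.comp (Primrec.snd.comp .fst)) .snd).to₂)).to₂
  · induction w with
    | nil => rfl
    | cons a w ih => exact congrArg (fun z => _ ++ List.map (a :: ·) z) ih

theorem primrec_toGifs [Nonempty X] [Nonempty Y] :
    Primrec (TapeEdge.toGifs (X := X) (Y := Y)) := by
  have hX : Fintype.card X ≠ 0 := Fintype.card_ne_zero
  have hY : Fintype.card Y ≠ 0 := Fintype.card_ne_zero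
  have hword : Primrec fun e : TapeEdge X Y => e.2.2.2 :=
    Primrec.snd.comp (Primrec.snd.comp .snd)
  have hletter : Primrec fun e : TapeEdge X Y => e.2.2.1 :=
    Primrec.fst.comp (Primrec.snd.comp .snd)
  have hlen : Primrec fun e : TapeEdge X Y => e.2.2.2.length := Primrec.list_length.comp hword
  have hinv : Primrec fun e : TapeEdge X Y =>
      1 / (Fintype.card Y : ℚ) ^ e.2.2.2.length := by
    simpa using primrec_rat_div_pow (.const 1) hlen hY
  have hnum : Primrec fun e : TapeEdge X Y =>
      (wordNum e.2.2.2 : ℚ) / (Fintype.card Y : ℚ) ^ e.2.2.2.length :=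
    primrec_rat_div_pow (primrec_wordNum.comp hword) hlen hY
  have hdigit : Primrec fun e : TapeEdge X Y =>
      ((Fintype.equivFin X e.2.2.1 : ℕ) : ℚ) / Fintype.card X :=
    (Primrec.dom_finite fun a : X => ((Fintype.equivFin X a : ℕ) : ℚ) / Fintype.card X).comp
      hletter
  refine Primrec.fst.pair ((Primrec.fst.comp .snd).pair (Primrec.pair ?_ ?_))
  · refine Primrec.fin_curry.2 (Primrec.fin_curry.2 ?_)
    refine Primrec.ite (Primrec.eq.comp (Primrec.snd.comp .fst) .snd)
      (Primrec.ite (Primrec.eq.comp (Primrec.snd.comp .fst) (.const 0)) (.const _) ?_) (.const 0)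
    exact hinv.comp (Primrec.fst.comp .fst)
  · refine Primrec.fin_curry.2 ?_
    exact Primrec.ite (Primrec.eq.comp .snd (.const 0)) (hdigit.comp .fst) (hnum.comp .fst)

variable {I A : Type} [Fintype I] [DecidableEq I] [Fintype A] [DecidableEq A]
  [Primcodable I] [Primcodable A]

theorem primrec_tapeEdges (u v : I → List A) : Primrec fun u₀ => tapeEdges u₀ u v := by
  have hcons : Primrec fun w : List (Option (Option A)) => (some none : Option (Option A)) :: w :=
    Primrec.list_cons.comp (.const _) .id
  have hbranch : Primrec fun s => branchEdges 1 s u := by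
    unfold branchEdges
    refine Primrec.list_append.comp (Primrec.list_append.comp (Primrec.list_append.comp ?_
      (.const _)) (.const _)) (.const _)
    refine Primrec.list_cons.comp ?_
      (Primrec.list_map (primrec_mismatches.comp primrec_embedWord) ?_)
    · exact (Primrec.const _).pair ((Primrec.const _).pair ((Primrec.const _).pair
        (hcons.comp primrec_embedWord)))
    · exact ((Primrec.const _).pair ((Primrec.const _).pair ((Primrec.const _).pair
        (hcons.comp .snd)))).to₂
  exact Primrec.list_append.comp (.const _) (Primrec.list_append.comp hbranch (.const _))

/-- If the empty interior problem for attractors were decidable, then so would be every family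
of correspondence problems in which only the start word varies, in a computable way. -/
theorem computablePred_exists_eq [Nonempty I] [Nonempty A] {f : List GifsEdge × Fin 3 → Bool}
    (hf : Computable f)
    (hf' : ∀ inst : List GifsEdge × Fin 3, GifsWF inst.1 →
      (f inst = true ↔ ∀ X : Fin 3 → Set (EuclideanSpace ℝ (Fin 2)),
        IsGifsAttractor inst.1 X → interior (X inst.2) = ∅))
    {u v : I → List A} (hu : ∀ i, u i ≠ []) (hv : ∀ i, v i ≠ []) :
    ComputablePred fun u₀ : List A => ∃ w : List I, u₀ ++ w.flatMap u = w.flatMap v := by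
  have hinst : Primrec fun u₀ : List A =>
      ((tapeEdges u₀ u v).map TapeEdge.toGifs, (0 : Fin 3)) :=
    (Primrec.list_map (primrec_tapeEdges u v) (primrec_toGifs.comp .snd).to₂).pair (.const 0)
  refine ComputablePred.computable_iff.2 ⟨_, hf.comp hinst.to_comp, ?_⟩
  funext u₀
  refine propext ?_
  rw [hf' _ (gifsWF_map_toGifs (tapeEdges_ne_nil hu hv) (exists_mem_tapeEdges u₀ u v))]
  constructor
  · rintro ⟨w, hw⟩ Z hZ
    exact interior_eq_empty_of_exists_eq hu hv hw hZ
  · intro h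
    by_contra! hne
    obtain ⟨Z, hZ, hsub⟩ := exists_isGifsAttractor_of_forall_ne hne
    exact (interior_nonempty_of_unitSquare_subset hsub).ne_empty (h Z hZ)

end Encoding

/-! ### From string rewriting to the modified correspondence problem -/

section Rewriting

open Relation

variable {B J : Type}

/-- One step of the string rewriting system with rules `l j → r j`. -/
def Rewrites (l r : J → List B) (s s' : List B) : Prop :=
  ∃ (p q : List B) (j : J), s = p ++ (l j ++ q) ∧ s' = p ++ (r j ++ q)

theorem Rewrites.append {l r : J → List B} {s s' : List B} (h : Rewrites l r s s')
    (z : List B) : Rewrites l r (s ++ z) (s' ++ z) := by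
  obtain ⟨p, q, j, rfl, rfl⟩ := h
  exact ⟨p, q ++ z, j, by simp, by simp⟩

theorem reflTransGen_rewrites_append {l r : J → List B} {s s' : List B}
    (h : ReflTransGen (Rewrites l r) s s') (z : List B) :
    ReflTransGen (Rewrites l r) (s ++ z) (s' ++ z) :=
  h.lift (· ++ z) fun _ _ h => h.append z

theorem eq_nil_of_reflTransGen_rewrites {l r : J → List B} (hr : ∀ j, r j ≠ []) {s : List B}
    (h : ReflTransGen (Rewrites l r) s []) : s = [] := by
  obtain h | ⟨s', -, p, q, j, -, h⟩ := h.cases_tail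
  · exact h.symm
  · exact absurd (List.append_eq_nil_iff.1 (List.append_eq_nil_iff.1 h.symm).2).1 (hr j)

/-- The top words of the correspondence problem of a rewriting system. -/
def tileTop (r : J → List B) : Option (Option (B ⊕ J)) → List (Option (Option B))
  | none => [none]
  | some none => [some none]
  | some (some (Sum.inl c)) => [some (some c)]
  | some (some (Sum.inr j)) => embedWord (r j)

/-- The bottom words of the correspondence problem of a rewriting system with target `t`. -/
def tileBot (l : J → List B) (t : List B) :
    Option (Option (B ⊕ J)) → List (Option (Option B))
  | none => embedWord t ++ [some none, none]
  | some none => [some none]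
  | some (some (Sum.inl c)) => [some (some c)]
  | some (some (Sum.inr j)) => embedWord (l j)

theorem tileTop_ne_nil {r : J → List B} (hr : ∀ j, r j ≠ []) :
    ∀ i, tileTop r i ≠ [] := by
  rintro (_ | _ | c | j)
  · simp [tileTop]
  · simp [tileTop]
  · simp [tileTop]
  · simpa [tileTop, embedWord] using hr j

theorem tileBot_ne_nil {l : J → List B} (hl : ∀ j, l j ≠ []) (t : List B) :
    ∀ i, tileBot l t i ≠ [] := by
  rintro (_ | _ | c | j)
  · simp [tileBot]
  · simp [tileBot]
  · simp [tileBot]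
  · simpa [tileBot, embedWord] using hl j

/-- The tile sequence copying the word `p`. -/
def copyTiles (J : Type) (p : List B) : List (Option (Option (B ⊕ J))) :=
  p.map fun c => some (some (Sum.inl c))

theorem flatMap_tileTop_copyTiles (r : J → List B) (p : List B) :
    (copyTiles J p).flatMap (tileTop r) = embedWord p := by
  induction p with
  | nil => rfl
  | cons c p ih => simpa [copyTiles, tileTop] using ih

theorem flatMap_tileBot_copyTiles (l : J → List B) (t p : List B) :
    (copyTiles J p).flatMap (tileBot l t) = embedWord p := by
  induction p with
  | nil => rfl
  | cons c p ih => simpa [copyTiles, tileBot] using ih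

theorem exists_eq_of_reflTransGen_rewrites {l r : J → List B} {s t : List B}
    (h : ReflTransGen (Rewrites l r) s t) :
    ∃ w : List (Option (Option (B ⊕ J))),
      (embedWord s ++ [some none]) ++ w.flatMap (tileTop r) = w.flatMap (tileBot l t) := by
  induction h using ReflTransGen.head_induction_on with
  | refl => exact ⟨[none], by simp [tileTop, tileBot]⟩
  | head h _ ih =>
    obtain ⟨p, q, j, rfl, rfl⟩ := h
    obtain ⟨w, hw⟩ := ih
    refine ⟨copyTiles J p ++ some (some (Sum.inr j)) :: copyTiles J q ++ some none :: w, ?_⟩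
    simp only [List.flatMap_append, List.flatMap_cons, flatMap_tileTop_copyTiles,
      flatMap_tileBot_copyTiles, ← hw]
    simp [tileTop, tileBot]

theorem exists_of_embedWord_append_eq {c p : List B} {x y : List (Option (Option B))}
    (h : embedWord c ++ some none :: x = embedWord p ++ y) :
    ∃ c', c = p ++ c' ∧ y = embedWord c' ++ some none :: x := by
  induction p generalizing c with
  | nil => exact ⟨c, rfl, h.symm⟩
  | cons a p ih =>
    cases c with
    | nil => simp at h
    | cons b c =>
      simp only [embedWord_cons, List.cons_append, List.cons.injEq, Option.some.injEq] at h
      obtain ⟨c', rfl, hy⟩ := ih h.2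
      exact ⟨c', by rw [h.1]; rfl, hy⟩

theorem reflTransGen_of_flatMap_eq {l r : J → List B} (hr : ∀ j, r j ≠ []) {t : List B}
    (w : List (Option (Option (B ⊕ J)))) {c d p : List B}
    (hw : embedWord c ++ some none :: (embedWord d ++ w.flatMap (tileTop r)) =
      w.flatMap (tileBot l t))
    (hp : ReflTransGen (Rewrites l r) p d) : ReflTransGen (Rewrites l r) (p ++ c) t := by
  induction w generalizing c d p with
  | nil => simp at hw
  | cons i w ih =>
    rw [List.flatMap_cons, List.flatMap_cons] at hw
    rcases i with _ | _ | a | j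
    · simp only [tileBot, tileTop, List.append_assoc, List.cons_append, List.nil_append] at hw
      obtain ⟨c', rfl, hc⟩ := exists_of_embedWord_append_eq hw
      cases c' with
      | cons a c' => simp at hc
      | nil =>
        cases d with
        | cons a d => simp at hc
        | nil =>
          rw [eq_nil_of_reflTransGen_rewrites hr hp, List.append_nil, List.nil_append]
    · simp only [tileBot, tileTop, List.cons_append, List.nil_append] at hw
      cases c with
      | cons a c => simp at hw
      | nil =>
        rw [List.append_nil]
        refine hp.trans ?_
        exact ih (c := d) (d := []) (p := []) (by simpa using hw) .refl
    · obtain ⟨c', rfl, hc⟩ := exists_of_embedWord_append_eq (p := [a]) hw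
      have := ih (c := c') (d := d ++ [a]) (p := p ++ [a]) (by rw [hc]; simp [tileTop])
        (reflTransGen_rewrites_append hp [a])
      simpa using this
    · obtain ⟨c', rfl, hc⟩ := exists_of_embedWord_append_eq (p := l j) hw
      have := ih (c := c') (d := d ++ r j) (p := p ++ l j) (by rw [hc]; simp [tileTop])
        ((reflTransGen_rewrites_append hp (l j)).tail ⟨d, [], j, by simp, by simp⟩)
      simpa using this

theorem reflTransGen_rewrites_iff_exists_eq {l r : J → List B} (hr : ∀ j, r j ≠ [])
    (s t : List B) : ReflTransGen (Rewrites l r) s t ↔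
      ∃ w : List (Option (Option (B ⊕ J))),
      (embedWord s ++ [some none]) ++ w.flatMap (tileTop r) = w.flatMap (tileBot l t) := by
  refine ⟨exists_eq_of_reflTransGen_rewrites, fun ⟨w, hw⟩ => ?_⟩
  exact reflTransGen_of_flatMap_eq hr w (c := s) (d := []) (p := []) (by simpa using hw) .refl

end Rewriting

/-! ### From Turing machines to string rewriting -/

section TuringRewriting

open Turing

/-- The letters of the rewriting system of a Turing machine. -/
inductive TMLetter (Γ Λ : Type) : Type
  | sym : Γ → TMLetter Γ Λ
  | state : Λ → TMLetter Γ Λ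
  | leftEnd : TMLetter Γ Λ
  | rightEnd : TMLetter Γ Λ
  | done : TMLetter Γ Λ

open TMLetter

instance {Γ Λ : Type} [Finite Γ] [Finite Λ] : Finite (TMLetter Γ Λ) :=
  Finite.of_injective (β := (Γ ⊕ Λ) ⊕ Fin 3)
    (fun c => match c with
      | sym a => Sum.inl (Sum.inl a)
      | state q => Sum.inl (Sum.inr q)
      | leftEnd => Sum.inr 0
      | rightEnd => Sum.inr 1
      | done => Sum.inr 2)
    (by rintro (_ | _ | _ | _ | _) (_ | _ | _ | _ | _) h <;> simp_all)

variable {Γ Λ : Type} [Inhabited Γ]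

section Rules

variable [Inhabited Λ]

/-- The rules of the rewriting system of a Turing machine. -/
inductive TMRule (M : TM0.Machine Γ Λ) : List (TMLetter Γ Λ) → List (TMLetter Γ Λ) → Prop
  | write {q a q' b} (h : M q a = some (q', TM0.Stmt.write b)) :
      TMRule M [state q, sym a] [state q', sym b]
  | moveRight {q a q'} (h : M q a = some (q', TM0.Stmt.move Dir.right)) :
      TMRule M [state q, sym a] [sym a, state q']
  | moveLeft {q a q'} (c) (h : M q a = some (q', TM0.Stmt.move Dir.left)) :
      TMRule M [sym c, state q, sym a] [state q', sym c, sym a]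
  | halt {q a} (h : M q a = none) : TMRule M [state q, sym a] [done]
  | extendLeft (q) : TMRule M [leftEnd, state q] [leftEnd, sym default, state q]
  | extendRight (q) : TMRule M [state q, rightEnd] [state q, sym default, rightEnd]
  | eatLeft (a) : TMRule M [sym a, done] [done]
  | eatRight (a) : TMRule M [done, sym a] [done]
  | eatLeftEnd : TMRule M [leftEnd, done] [done]
  | eatRightEnd : TMRule M [done, rightEnd] [done]

/-- The index type of the rules of the rewriting system of a Turing machine. -/
abbrev TMRuleIndex (M : TM0.Machine Γ Λ) : Type :=
  {p : List (TMLetter Γ Λ) × List (TMLetter Γ Λ) // TMRule M p.1 p.2}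

theorem finite_tmRuleIndex [Finite Γ] [Finite Λ] (M : TM0.Machine Γ Λ) :
    Finite (TMRuleIndex M) := by
  have h := (List.finite_length_le (TMLetter Γ Λ) 3).prod (List.finite_length_le (TMLetter Γ Λ) 3)
  refine (h.subset ?_ : Set.Finite {p | TMRule M p.1 p.2}).to_subtype
  rintro ⟨l, r⟩ hlr
  change TMRule M l r at hlr
  cases hlr <;> simp

theorem TMRule.left_ne_nil {M : TM0.Machine Γ Λ} {l r} (h : TMRule M l r) : l ≠ [] := by
  cases h <;> simp

theorem TMRule.right_ne_nil {M : TM0.Machine Γ Λ} {l r} (h : TMRule M l r) : r ≠ [] := by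
  cases h <;> simp

/-- One step of the rewriting system of a Turing machine. -/
abbrev TMRewrites (M : TM0.Machine Γ Λ) :
    List (TMLetter Γ Λ) → List (TMLetter Γ Λ) → Prop :=
  Rewrites (fun j : TMRuleIndex M => j.1.1) fun j => j.1.2

end Rules

/-- The word for a configuration with state `q`, reversed left part `l` and right part `r`. -/
def tmWord (l : List Γ) (q : Λ) (r : List Γ) : List (TMLetter Γ Λ) :=
  (l.map sym ++ [leftEnd]).reverse ++ state q :: (r.map sym ++ [rightEnd])

/-- The configuration with state `q`, reversed left part `l` and right part `r`. -/
def tmCfg (l : List Γ) (q : Λ) (r : List Γ) : TM0.Cfg Γ Λ :=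
  ⟨q, Tape.mk' (ListBlank.mk l) (ListBlank.mk r)⟩

theorem listBlank_mk_default : ListBlank.mk [(default : Γ)] = ListBlank.mk [] :=
  Quotient.sound (Or.inr ⟨1, rfl⟩)

theorem tmCfg_write (l : List Γ) (q q' : Λ) (a b : Γ) (r : List Γ) :
    (⟨q', (tmCfg l q (a :: r)).Tape.write b⟩ : TM0.Cfg Γ Λ) = tmCfg l q' (b :: r) := by
  simp [tmCfg, ← ListBlank.cons_mk, Tape.write_mk']

theorem tmCfg_moveRight (l : List Γ) (q q' : Λ) (a : Γ) (r : List Γ) :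
    (⟨q', (tmCfg l q (a :: r)).Tape.move Dir.right⟩ : TM0.Cfg Γ Λ) = tmCfg (a :: l) q' r := by
  simp [tmCfg, ← ListBlank.cons_mk, Tape.move_right_mk']

theorem tmCfg_moveLeft (c : Γ) (l : List Γ) (q q' : Λ) (r : List Γ) :
    (⟨q', (tmCfg (c :: l) q r).Tape.move Dir.left⟩ : TM0.Cfg Γ Λ) = tmCfg l q' (c :: r) := by
  simp [tmCfg, ← ListBlank.cons_mk, Tape.move_left_mk']

theorem tmWord_eq_append {l : List Γ} {q : Λ} {r : List Γ} {q' : Λ} {x y : List (TMLetter Γ Λ)}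
    (h : tmWord l q r = x.reverse ++ state q' :: y) :
    l.map sym ++ [leftEnd] = x ∧ q = q' ∧ r.map sym ++ [rightEnd] = y := by
  have := (List.append_cons_inj_of_notMem (by simp) (by simp)).1 h
  simpa [-List.reverse_append] using this

theorem done_notMem_tmWord (l : List Γ) (q : Λ) (r : List Γ) : done ∉ tmWord l q r := by
  simp [tmWord]

variable [Inhabited Λ]

theorem TMRule.rewrites {M : TM0.Machine Γ Λ} {l r} (h : TMRule M l r) (p q) :
    TMRewrites M (p ++ (l ++ q)) (p ++ (r ++ q)) :=
  ⟨p, q, ⟨(l, r), h⟩, rfl, rfl⟩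

theorem tmWord_extendRight (M : TM0.Machine Γ Λ) (l : List Γ) (q : Λ) (r : List Γ) :
    ∃ a r', tmCfg l q r = tmCfg l q (a :: r') ∧
      Relation.ReflTransGen (TMRewrites M) (tmWord l q r) (tmWord l q (a :: r')) := by
  cases r with
  | nil =>
    refine ⟨default, [], by simp [tmCfg, listBlank_mk_default], .single ?_⟩
    exact (TMRule.extendRight (M := M) q).rewrites (l.map sym ++ [leftEnd]).reverse []
  | cons a r => exact ⟨a, r, rfl, .refl⟩

theorem tmWord_extendLeft (M : TM0.Machine Γ Λ) (l : List Γ) (q : Λ) (r : List Γ) :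
    ∃ a l', tmCfg l q r = tmCfg (a :: l') q r ∧
      Relation.ReflTransGen (TMRewrites M) (tmWord l q r) (tmWord (a :: l') q r) := by
  cases l with
  | nil =>
    refine ⟨default, [], by simp [tmCfg, listBlank_mk_default], .single ?_⟩
    simpa [tmWord] using (TMRule.extendLeft (M := M) q).rewrites [] (r.map sym ++ [rightEnd])
  | cons a l => exact ⟨a, l, rfl, .refl⟩

theorem tmCfg_step (M : TM0.Machine Γ Λ) (l : List Γ) (q : Λ) (a : Γ) (r : List Γ) :
    TM0.step M (tmCfg l q (a :: r)) = (M q a).map fun x => ⟨x.1, match x.2 with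
      | TM0.Stmt.move d => (tmCfg l q (a :: r)).Tape.move d
      | TM0.Stmt.write a' => (tmCfg l q (a :: r)).Tape.write a'⟩ := by
  simp only [TM0.step, tmCfg, Tape.mk'_head, ListBlank.head_mk, List.headI_cons]
  rfl

theorem reflTransGen_tmRewrites_step (M : TM0.Machine Γ Λ) (l : List Γ) (q : Λ) (r : List Γ)
    {c : TM0.Cfg Γ Λ} (hc : c ∈ TM0.step M (tmCfg l q r)) :
    ∃ l' q' r', c = tmCfg l' q' r' ∧
      Relation.ReflTransGen (TMRewrites M) (tmWord l q r) (tmWord l' q' r') := by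
  obtain ⟨a, r, h, hr⟩ := tmWord_extendRight M l q r
  obtain ⟨b, l, h', hl⟩ := tmWord_extendLeft M l q (a :: r)
  rw [h, h', tmCfg_step] at hc
  obtain ⟨⟨q', s⟩, hM, rfl⟩ := Option.map_eq_some_iff.1 hc
  rcases s with (_ | _) | a'
  · refine ⟨l, q', b :: a :: r, tmCfg_moveLeft .., hr.trans (hl.trans (.single ?_))⟩
    have h := (TMRule.moveLeft b hM).rewrites
      (l.map sym ++ [leftEnd]).reverse (r.map sym ++ [rightEnd])
    simpa [tmWord] using h
  · refine ⟨a :: b :: l, q', r, tmCfg_moveRight .., hr.trans (hl.trans (.single ?_))⟩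
    have h := (TMRule.moveRight hM).rewrites
      ((b :: l).map sym ++ [leftEnd]).reverse (r.map sym ++ [rightEnd])
    simpa [tmWord] using h
  · refine ⟨b :: l, q', a' :: r, tmCfg_write .., hr.trans (hl.trans (.single ?_))⟩
    exact (TMRule.write hM).rewrites
      ((b :: l).map sym ++ [leftEnd]).reverse (r.map sym ++ [rightEnd])

theorem reflTransGen_tmRewrites_of_reaches (M : TM0.Machine Γ Λ) (l : List Γ) (q : Λ) (r : List Γ)
    {c : TM0.Cfg Γ Λ} (hc : StateTransition.Reaches (TM0.step M) (tmCfg l q r) c) :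
    ∃ l' q' r', c = tmCfg l' q' r' ∧
      Relation.ReflTransGen (TMRewrites M) (tmWord l q r) (tmWord l' q' r') := by
  induction hc with
  | refl => exact ⟨l, q, r, rfl, .refl⟩
  | tail _ h ih =>
    obtain ⟨l', q', r', rfl, h'⟩ := ih
    obtain ⟨l'', q'', r'', rfl, h''⟩ := reflTransGen_tmRewrites_step M l' q' r' h
    exact ⟨l'', q'', r'', rfl, h'.trans h''⟩

theorem reflTransGen_tmRewrites_eatRight (M : TM0.Machine Γ Λ) (p : List (TMLetter Γ Λ))
    (r : List Γ) :
    Relation.ReflTransGen (TMRewrites M) (p ++ done :: (r.map sym ++ [rightEnd]))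
      (p ++ [done]) := by
  induction r with
  | nil => exact .single (by simpa using (TMRule.eatRightEnd (M := M)).rewrites p [])
  | cons a r ih =>
    refine .head ?_ ih
    simpa using (TMRule.eatRight (M := M) a).rewrites p (r.map sym ++ [rightEnd])

theorem reflTransGen_tmRewrites_eatLeft (M : TM0.Machine Γ Λ) (l : List Γ) :
    Relation.ReflTransGen (TMRewrites M) ((l.map sym ++ [leftEnd]).reverse ++ [done]) [done] := by
  induction l with
  | nil => exact .single (by simpa using (TMRule.eatLeftEnd (M := M)).rewrites [] [])
  | cons a l ih =>
    refine .head ?_ ih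
    have h := (TMRule.eatLeft (M := M) a).rewrites (l.map sym ++ [leftEnd]).reverse []
    simpa using h

theorem reflTransGen_tmRewrites_done (M : TM0.Machine Γ Λ) (l : List Γ) (q : Λ) (r : List Γ)
    (h : TM0.step M (tmCfg l q r) = none) :
    Relation.ReflTransGen (TMRewrites M) (tmWord l q r) [done] := by
  obtain ⟨a, r, h', hr⟩ := tmWord_extendRight M l q r
  rw [h', tmCfg_step, Option.map_eq_none_iff] at h
  refine hr.trans (.head ?_ ((reflTransGen_tmRewrites_eatRight M _ r).trans
    (reflTransGen_tmRewrites_eatLeft M l)))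
  exact (TMRule.halt h).rewrites
    (l.map sym ++ [leftEnd]).reverse (r.map sym ++ [rightEnd])

theorem tmRewrites_tmWord {M : TM0.Machine Γ Λ} {l : List Γ} {q : Λ} {r : List Γ}
    {s : List (TMLetter Γ Λ)} (h : TMRewrites M (tmWord l q r) s)
    (hM : TM0.step M (tmCfg l q r) ≠ none) :
    ∃ l' q' r', s = tmWord l' q' r' ∧
      StateTransition.Reaches (TM0.step M) (tmCfg l q r) (tmCfg l' q' r') := by
  obtain ⟨p, z, ⟨⟨u, v⟩, hj⟩, h, rfl⟩ := h
  have key : ∀ x q' y, p ++ (u ++ z) = x.reverse ++ state q' :: y →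
      l.map sym ++ [leftEnd] = x ∧ q = q' ∧ r.map sym ++ [rightEnd] = y :=
    fun x q' y hx => tmWord_eq_append (h.trans hx)
  have hdone : ∀ x y, p ++ (u ++ z) ≠ x ++ done :: y := fun x y hx =>
    done_notMem_tmWord l q r (h.trans hx ▸ by simp)
  change TMRule M u v at hj
  cases hj with
  | @write q₁ a q' b hj =>
    obtain ⟨hl, rfl, hr⟩ := key p.reverse q₁ (sym a :: z) (by simp)
    obtain _ | ⟨a, r⟩ := r
    · simp at hr
    obtain ⟨⟨⟩, rfl⟩ := List.cons.inj hr
    refine ⟨l, q', b :: r, by simp [tmWord, ← List.reverse_eq_iff.2 hl], .single ?_⟩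
    rw [tmCfg_step, hj, Option.map_some, ← tmCfg_write l q q' a b r]; rfl
  | @moveRight q₁ a q' hj =>
    obtain ⟨hl, rfl, hr⟩ := key p.reverse q₁ (sym a :: z) (by simp)
    obtain _ | ⟨a, r⟩ := r
    · simp at hr
    obtain ⟨⟨⟩, rfl⟩ := List.cons.inj hr
    refine ⟨a :: l, q', r, by simp [tmWord, ← List.reverse_eq_iff.2 hl], .single ?_⟩
    rw [tmCfg_step, hj, Option.map_some, ← tmCfg_moveRight l q q' a r]; rfl
  | @moveLeft q₁ a q' c hj =>
    obtain ⟨hl, rfl, hr⟩ := key (sym c :: p.reverse) q₁ (sym a :: z) (by simp)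
    obtain _ | ⟨a, r⟩ := r
    · simp at hr
    obtain _ | ⟨c, l⟩ := l
    · simp at hl
    obtain ⟨⟨⟩, rfl⟩ := List.cons.inj hr
    obtain ⟨⟨⟩, hl'⟩ := List.cons.inj hl
    obtain rfl : (l.map sym ++ [leftEnd]).reverse = p := by
      rw [← List.reverse_reverse p, ← hl']; rfl
    refine ⟨l, q', c :: a :: r, by simp [tmWord], .single ?_⟩
    rw [tmCfg_step, hj, Option.map_some, ← tmCfg_moveLeft c l q q' (a :: r)]; rfl
  | @halt q₁ a hj =>
    obtain ⟨hl, rfl, hr⟩ := key p.reverse q₁ (sym a :: z) (by simp)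
    obtain _ | ⟨a, r⟩ := r
    · simp at hr
    obtain ⟨⟨⟩, rfl⟩ := List.cons.inj hr
    exact absurd (by rw [tmCfg_step, hj, Option.map_none]) hM
  | extendLeft q₁ =>
    obtain ⟨hl, rfl, hr⟩ := key (leftEnd :: p.reverse) q₁ z (by simp)
    obtain _ | ⟨c, l⟩ := l
    · obtain rfl : p = [] := by simpa using hl
      refine ⟨[default], q, r, by simp [tmWord, hr], ?_⟩
      rw [tmCfg, tmCfg, listBlank_mk_default]
      exact .refl
    · simp at hl
  | extendRight q₁ =>
    obtain ⟨hl, rfl, hr⟩ := key p.reverse q₁ (rightEnd :: z) (by simp)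
    obtain _ | ⟨c, r⟩ := r
    · obtain rfl : z = [] := by simpa using hr
      refine ⟨l, q, [default], by simp [tmWord, ← List.reverse_eq_iff.2 hl], ?_⟩
      rw [tmCfg, tmCfg, listBlank_mk_default]
      exact .refl
    · simp at hr
  | eatLeft a => exact absurd (by simp) (hdone (p ++ [sym a]) z)
  | eatRight a => exact absurd (by simp) (hdone p (sym a :: z))
  | eatLeftEnd => exact absurd (by simp) (hdone (p ++ [leftEnd]) z)
  | eatRightEnd => exact absurd (by simp) (hdone p (rightEnd :: z))

/-- A Turing machine halts exactly if its rewriting system rewrites the word of the initial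
configuration to the one letter word `done`. -/
theorem eval_dom_iff_reflTransGen_tmRewrites (M : TM0.Machine Γ Λ) (r : List Γ) :
    (TM0.eval M r).Dom ↔
      Relation.ReflTransGen (TMRewrites M) (tmWord [] default r) [done] := by
  have hstart : TM0.init r = tmCfg [] (default : Λ) r := rfl
  rw [TM0.eval, Part.map_Dom, hstart]
  constructor
  · intro h
    obtain ⟨hreach, hhalt⟩ := StateTransition.mem_eval.1 (Part.get_mem h)
    obtain ⟨l', q', r', hc, hrew⟩ := reflTransGen_tmRewrites_of_reaches M [] default r hreach
    exact hrew.trans (reflTransGen_tmRewrites_done M l' q' r' (hc ▸ hhalt))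
  · contrapose
    intro h hrew
    have hne : ∀ c, StateTransition.Reaches (TM0.step M) (tmCfg [] default r) c →
        TM0.step M c ≠ none := fun c hc hcn =>
      h (Part.dom_iff_mem.2 ⟨c, StateTransition.mem_eval.2 ⟨hc, hcn⟩⟩)
    have : ∀ s, Relation.ReflTransGen (TMRewrites M) (tmWord [] default r) s →
        ∃ l' q' r', s = tmWord l' q' r' ∧
          StateTransition.Reaches (TM0.step M) (tmCfg [] default r) (tmCfg l' q' r') := by
      intro s hs
      induction hs with
      | refl => exact ⟨[], default, r, rfl, .refl⟩
      | tail _ hstep ih =>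
        obtain ⟨l', q', r', rfl, hreach⟩ := ih
        obtain ⟨l'', q'', r'', rfl, hreach'⟩ := tmRewrites_tmWord hstep (hne _ hreach)
        exact ⟨l'', q'', r'', rfl, hreach.trans hreach'⟩
    obtain ⟨l', q', r', hs, -⟩ := this _ hrew
    exact done_notMem_tmWord l' q' r' (hs ▸ by simp)

end TuringRewriting

/-! ### A Turing machine with undecidable halting problem -/

section UndecidableMachine

open Turing

/-- A Turing machine with finitely many reachable states can be replaced by one with finitely
many states. -/
theorem exists_finite_machine {Γ Λ : Type} [Inhabited Γ] [Inhabited Λ] (M : TM0.Machine Γ Λ)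
    {S : Set Λ} (hS : S.Finite) (ss : TM0.Supports M S) :
    ∃ (Λ' : Type) (_ : Finite Λ') (_ : Inhabited Λ') (M' : TM0.Machine Γ Λ'),
      ∀ l, (TM0.eval M' l).Dom ↔ (TM0.eval M l).Dom := by
  classical
  have : Finite S := hS.to_subtype
  let _ : Inhabited S := ⟨⟨default, ss.1⟩⟩
  let f : PointedMap Γ Γ := ⟨id, rfl⟩
  let g₁ : PointedMap Λ S := ⟨fun q => if h : q ∈ S then ⟨q, h⟩ else default, by
    rw [dif_pos ss.1]; rfl⟩
  refine ⟨S, inferInstance, inferInstance, TM0.Machine.map M f f g₁ Subtype.val, fun l => ?_⟩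
  have hresp := TM0.Machine.map_respects M f f g₁ Subtype.val ss (fun _ => rfl)
    (fun q hq => by simp [g₁, hq])
  have hstart : TM0.Cfg.map f g₁ (TM0.init l) = TM0.init l := by
    rw [TM0.map_init]
    exact congrArg TM0.init (List.map_id l)
  exact StateTransition.tr_eval_dom hresp (a₁ := TM0.init l) ⟨ss.1, hstart⟩

theorem trNat_two_pow (k : ℕ) :
    PartrecToTM2.trNat (2 ^ k) = List.replicate k PartrecToTM2.Γ'.bit0 ++ [.bit1] := by
  have h : ((PosNum.bit0^[k] PosNum.one : PosNum) : ℕ) = 2 ^ k := by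
    induction k with
    | zero => rfl
    | succ k ih => rw [Function.iterate_succ_apply', PosNum.cast_bit0, ih, pow_succ]; ring
  have h' : ((2 ^ k : ℕ) : Num) = Num.pos (PosNum.bit0^[k] PosNum.one) := by
    rw [← h]
    exact Num.of_to_nat (Num.pos _)
  rw [PartrecToTM2.trNat, h', PartrecToTM2.trNum]
  clear h h'
  induction k with
  | zero => rfl
  | succ k ih =>
    rw [Function.iterate_succ_apply', PartrecToTM2.trPosNum, ih, List.replicate_succ,
      List.cons_append]

/-- Every stack machine with finitely many reachable states is simulated by a Turing machine,
which is given the input stack from bottom to top. -/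
theorem exists_machine_of_stackMachine {K G Λ σ : Type} [DecidableEq K] [Finite K] [Finite G]
    [Inhabited Λ] [Inhabited σ] [Finite σ] (M : Λ → TM2.Stmt (fun _ : K => G) Λ σ) (k₀ : K)
    {S : Finset Λ} (ss : TM2.Supports M S) :
    ∃ (Γ Λ' : Type) (_ : Finite Γ) (_ : Finite Λ') (_ : Inhabited Γ) (_ : Inhabited Λ')
      (M' : TM0.Machine Γ Λ') (bottom sym : G → Γ), ∀ (a : G) (L : List G),
        (TM0.eval M' (bottom a :: L.map sym)).Dom ↔ (TM2.eval M k₀ (L.reverse ++ [a])).Dom := by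
  have := Fintype.ofFinite K
  have := Fintype.ofFinite G
  have := Fintype.ofFinite σ
  obtain ⟨Λ', hΛ', iΛ', M', hM'⟩ := exists_finite_machine _ (Finset.finite_toSet _)
    (TM1to0.tr_supports _ (TM2to1.tr_supports _ ss))
  refine ⟨_, Λ', inferInstance, hΛ', inferInstance, iΛ', M',
    fun a => (true, Function.update (fun _ => none) k₀ (some a)),
    fun a => (false, Function.update (fun _ => none) k₀ (some a)), fun a L => ?_⟩
  rw [hM', TM1to0.tr_eval, ← TM2to1.tr_eval_dom]
  simp only [TM2to1.trInit, List.reverse_append, List.reverse_singleton, List.reverse_reverse,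
    List.singleton_append]
  rfl

/-- Every code for a partial recursive function is simulated by a Turing machine. -/
theorem exists_machine_of_code (c : ToPartrec.Code) :
    ∃ (Γ Λ : Type) (_ : Finite Γ) (_ : Finite Λ) (_ : Inhabited Γ) (_ : Inhabited Λ)
      (M : TM0.Machine Γ Λ) (α : List Γ) (β : Γ), ∀ k : ℕ,
        (TM0.eval M (α ++ List.replicate k β)).Dom ↔ (c.eval [2 ^ k]).Dom := by
  let _ : Inhabited PartrecToTM2.Λ' := ⟨PartrecToTM2.trNormal c PartrecToTM2.Cont'.halt⟩
  have : Finite PartrecToTM2.K' := Finite.of_surjective (α := Fin 4)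
    ![.main, .rev, .aux, .stack] (by
      rintro (_ | _ | _ | _)
      exacts [⟨0, rfl⟩, ⟨1, rfl⟩, ⟨2, rfl⟩, ⟨3, rfl⟩])
  obtain ⟨Γ, Λ, hΓ, hΛ, iΓ, iΛ, M, bottom, sym, h⟩ := exists_machine_of_stackMachine
    PartrecToTM2.tr .main (PartrecToTM2.tr_supports c PartrecToTM2.Cont'.halt)
  refine ⟨Γ, Λ, hΓ, hΛ, iΓ, iΛ, M, [bottom .cons, sym .bit1], sym .bit0, fun k => ?_⟩
  have hcfg : TM2.init (Γ := fun _ => PartrecToTM2.Γ') PartrecToTM2.K'.main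
      ((PartrecToTM2.Γ'.bit1 :: List.replicate k PartrecToTM2.Γ'.bit0).reverse ++ [.cons]) =
        PartrecToTM2.init c [2 ^ k] := by
    refine congrArg (TM2.Cfg.mk _ _) (funext fun i => ?_)
    cases i
    · simp [trNat_two_pow]
    all_goals rfl
  have hk := h .cons (.bit1 :: List.replicate k .bit0)
  rw [List.map_cons, List.map_replicate] at hk
  refine hk.trans ?_
  change (StateTransition.eval _ (TM2.init _ _)).Dom ↔ _
  rw [hcfg]
  exact iff_of_eq (congrArg Part.Dom (PartrecToTM2.tr_eval c [2 ^ k]))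

/-- There is a Turing machine with an undecidable halting problem for inputs of the form
`α ++ β ^ k`. -/
theorem exists_machine_not_computablePred :
    ∃ (Γ Λ : Type) (_ : Finite Γ) (_ : Finite Λ) (_ : Inhabited Γ) (_ : Inhabited Λ)
      (M : TM0.Machine Γ Λ) (α : List Γ) (β : Γ),
        ¬ ComputablePred fun k : ℕ => (TM0.eval M (α ++ List.replicate k β)).Dom := by
  let f : ℕ →. ℕ := fun m => (Nat.rfind fun k => Part.some (decide (2 ^ k = m))).bind fun k =>
    Nat.Partrec.Code.eval (Denumerable.ofNat Nat.Partrec.Code k) 0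
  have hpow : Primrec fun k : ℕ => 2 ^ k :=
    (Primrec.nat_rec₁ 1 (Primrec.nat_mul.comp (Primrec.const 2) Primrec.snd).to₂).of_eq fun k => by
      induction k with
      | zero => rfl
      | succ k ih => simp only [ih, pow_succ']
  have hf : Partrec f := by
    refine Partrec.bind (Partrec.rfind ?_) ?_
    · exact (PrimrecPred.decide
        (Primrec.eq.comp (hpow.comp Primrec.snd) Primrec.fst)).to_comp.partrec
    · exact Nat.Partrec.Code.eval_part.comp ((Computable.ofNat _).comp Computable.snd)
        (Computable.const 0)
  have hfk : ∀ k : ℕ, f (2 ^ k) =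
      Nat.Partrec.Code.eval (Denumerable.ofNat Nat.Partrec.Code k) 0 := by
    intro k
    have : k ∈ Nat.rfind fun i => Part.some (decide (2 ^ i = 2 ^ k)) := by
      refine Nat.mem_rfind.2 ⟨by simp, fun {m} hm => by simp [hm.ne]⟩
    simp only [f, Part.eq_some_iff.2 this, Part.bind_some]
  obtain ⟨c, hc⟩ := ToPartrec.Code.exists_code (Nat.Partrec'.part_iff₁.2 hf)
  obtain ⟨Γ, Λ, hΓ, hΛ, iΓ, iΛ, M, α, β, h⟩ := exists_machine_of_code c
  refine ⟨Γ, Λ, hΓ, hΛ, iΓ, iΛ, M, α, β, fun hcomp => ?_⟩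
  refine ComputablePred.halting_problem 0 ?_
  have key : ∀ e : Nat.Partrec.Code,
      (TM0.eval M (α ++ List.replicate (Encodable.encode e) β)).Dom ↔ (e.eval 0).Dom := by
    intro e
    have := hc ⟨[2 ^ Encodable.encode e], rfl⟩
    rw [h, this]
    change (Part.map _ (f (2 ^ Encodable.encode e))).Dom ↔ _
    rw [Part.map_Dom, hfk, Denumerable.ofNat_encode]
  exact ComputablePred.computable_of_manyOneReducible
    ⟨Encodable.encode, Computable.encode, fun e => (key e).symm⟩ hcomp

end UndecidableMachine

section Assembly

theorem computable_const_append_replicate {B : Type} [Primcodable B] (s t : List B) (b : B) :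
    Computable fun k : ℕ => s ++ List.replicate k b ++ t := by
  refine (Primrec.list_append.comp (Primrec.list_append.comp (.const s)
    ((Primrec.list_map Primrec.list_range (Primrec.const b).to₂).of_eq fun k => ?_))
    (.const t)).to_comp
  simp

open Relation in
/-- If the empty interior problem for attractors were decidable, then so would be reachability
of a fixed word in a finite string rewriting system. -/
theorem computablePred_reflTransGen_rewrites {B J : Type} [Finite B] [Finite J] [Primcodable B]
    {f : List GifsEdge × Fin 3 → Bool} (hf : Computable f)
    (hf' : ∀ inst : List GifsEdge × Fin 3, GifsWF inst.1 →
      (f inst = true ↔ ∀ X : Fin 3 → Set (EuclideanSpace ℝ (Fin 2)),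
        IsGifsAttractor inst.1 X → interior (X inst.2) = ∅))
    {l r : J → List B} (hl : ∀ j, l j ≠ []) (hr : ∀ j, r j ≠ []) (t : List B) :
    ComputablePred fun s : List B => ReflTransGen (Rewrites l r) s t := by
  classical
  have := Fintype.ofFinite B
  have := Fintype.ofFinite J
  have : Primcodable J := .ofEquiv _ (Fintype.equivFin J)
  have hstart : Computable fun s : List B => embedWord s ++ [some none] :=
    (Primrec.list_append.comp primrec_embedWord (.const _)).to_comp
  exact ComputablePred.computable_of_manyOneReducible
    ⟨_, hstart, fun s => reflTransGen_rewrites_iff_exists_eq hr s t⟩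
    (computablePred_exists_eq hf hf' (tileTop_ne_nil hr) (tileBot_ne_nil hl t))

end Assembly

/-- It is undecidable whether the attractor component `X_q` of a 2-dimensional rational
affine GIFS with 3 vertices (every vertex having an outgoing edge) has empty interior. -/
theorem undecidable_emptyInterior_gifs :
    ¬ ∃ f : List GifsEdge × Fin 3 → Bool, Computable f ∧
      ∀ inst : List GifsEdge × Fin 3, GifsWF inst.1 →
        (f inst = true ↔
          ∀ X : Fin 3 → Set (EuclideanSpace ℝ (Fin 2)),
            IsGifsAttractor inst.1 X → interior (X inst.2) = ∅) := by
  rintro ⟨f, hf, hf'⟩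
  obtain ⟨Γ, Λ, _, _, _, _, M, α, β, hM⟩ := exists_machine_not_computablePred
  have := finite_tmRuleIndex M
  have := Fintype.ofFinite (TMLetter Γ Λ)
  have : Primcodable (TMLetter Γ Λ) := .ofEquiv _ (Fintype.equivFinOfCardEq rfl)
  refine hM (ComputablePred.computable_of_manyOneReducible
    ⟨fun k => tmWord [] default (α ++ List.replicate k β), ?_,
      fun k => eval_dom_iff_reflTransGen_tmRewrites M _⟩
    (computablePred_reflTransGen_rewrites hf hf' (fun j => j.2.left_ne_nil)
      (fun j => j.2.right_ne_nil) [TMLetter.done]))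
  refine (computable_const_append_replicate
    (.leftEnd :: .state default :: α.map .sym) [.rightEnd] (.sym β)).of_eq fun k => ?_
  simp [tmWord]
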